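/- arXiv:0803.4281 — 2 statements merged into one kernel-verified Lean document; each statement's English description precedes it below -/
import Mathlib

section
/- (Deroin–Kleptsyn–Navas) Let G be a countable group with an orientation-preserving C¹ action ρ on the circle, where for each g ∈ G a lift F_g : ℝ → ℝ as in the definition is fixed. If there is no Borel probability measure on S¹ invariant under ρ(g) for all g ∈ G, then there exists g ∈ G such that the fixed-point set {p ∈ S¹ : ρ(g)(p) = p} is nonempty and finite, and every fixed point of ρ(g) is hyperbolic: for every x ∈ ℝ with ρ(g)(x mod 1) = x mod 1, the derivative of F_g at x is different from 1. -/
open MeasureTheory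

/-- The group of self-homeomorphisms of the circle `S¹ = ℝ/ℤ`,
with `f * g = f ∘ g`. -/
noncomputable instance : Group (UnitAddCircle ≃ₜ UnitAddCircle) where
  mul f g := g.trans f
  one := Homeomorph.refl _
  inv := Homeomorph.symm
  mul_assoc _ _ _ := Homeomorph.ext fun _ => rfl
  one_mul _ := Homeomorph.ext fun _ => rfl
  mul_one _ := Homeomorph.ext fun _ => rfl
  inv_mul_cancel a := Homeomorph.ext a.symm_apply_apply

/-- `F : ℝ → ℝ` is a `C¹` lift of the circle homeomorphism `f`: it is `C¹` with
nowhere-vanishing derivative, commutes with the deck transformation up to sign,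
and descends to `f` on `ℝ/ℤ`. -/
def IsC1Lift (f : UnitAddCircle ≃ₜ UnitAddCircle) (F : ℝ → ℝ) : Prop :=
  ContDiff ℝ 1 F ∧ (∀ x : ℝ, deriv F x ≠ 0) ∧
    ((∀ x : ℝ, F (x + 1) = F x + 1) ∨ (∀ x : ℝ, F (x + 1) = F x - 1)) ∧
    ∀ x : ℝ, f (x : UnitAddCircle) = ((F x : ℝ) : UnitAddCircle)

/-- A `C¹` action of a group `Γ` on the circle: a homomorphism into the
self-homeomorphisms of the circle all of whose values admit `C¹` lifts. -/
def IsC1Action {Γ : Type*} [Group Γ] (ρ : Γ →* (UnitAddCircle ≃ₜ UnitAddCircle)) : Prop :=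
  ∀ γ : Γ, ∃ F : ℝ → ℝ, IsC1Lift (ρ γ) F

/-- `F : ℝ → ℝ` is an orientation-preserving `C¹` lift of the circle
homeomorphism `f`: it is `C¹` with everywhere positive derivative,
satisfies `F (x+1) = F x + 1` and descends to `f` on `ℝ/ℤ`. -/
def IsOPC1Lift (f : UnitAddCircle ≃ₜ UnitAddCircle) (F : ℝ → ℝ) : Prop :=
  ContDiff ℝ 1 F ∧ (∀ x : ℝ, 0 < deriv F x) ∧
    (∀ x : ℝ, F (x + 1) = F x + 1) ∧
    ∀ x : ℝ, f (x : UnitAddCircle) = ((F x : ℝ) : UnitAddCircle)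

/-- `F : ℝ → ℝ` is an orientation-preserving (topological) lift of the circle
homeomorphism `f`: continuous, strictly increasing, satisfies
`F (x+1) = F x + 1`, and descends to `f` on `ℝ/ℤ`. -/
def IsOPLift (f : UnitAddCircle ≃ₜ UnitAddCircle) (F : ℝ → ℝ) : Prop :=
  Continuous F ∧ StrictMono F ∧
    (∀ x : ℝ, F (x + 1) = F x + 1) ∧
    ∀ x : ℝ, f (x : UnitAddCircle) = ((F x : ℝ) : UnitAddCircle)

section LiftSystem

/-- A family of `C¹` increasing degree-one maps of the line, indexed by a group and
multiplicative up to integer translations. -/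
structure IsLiftSystem {G : Type*} [Group G] (F : G → ℝ → ℝ) : Prop where
  contDiff : ∀ g, ContDiff ℝ 1 (F g)
  deriv_pos : ∀ g x, 0 < deriv (F g) x
  add_one : ∀ g x, F g (x + 1) = F g x + 1
  mul : ∀ g h, ∃ n : ℤ, ∀ x, F (g * h) x = F g (F h x) + n

theorem exists_int_of_coe_eq {f g : ℝ → ℝ} (hf : Continuous f) (hg : Continuous g)
    (h : ∀ x, ((f x : ℝ) : UnitAddCircle) = ((g x : ℝ) : UnitAddCircle)) :
    ∃ n : ℤ, ∀ x, f x = g x + n := by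
  have h1 : ∀ x, ∃ n : ℤ, f x - g x = n := by
    intro x
    have := h x
    rw [← sub_eq_zero, ← AddCircle.coe_sub, AddCircle.coe_eq_zero_iff] at this
    obtain ⟨n, hn⟩ := this
    exact ⟨n, by simpa using hn.symm⟩
  choose n hn using h1
  have hc : Continuous n := by
    rw [Int.isClosedEmbedding_coe_real.isInducing.continuous_iff]
    have : (Int.cast ∘ n : ℝ → ℝ) = fun x => f x - g x := by
      ext x; rw [hn, Function.comp_apply]
    exact this.symm ▸ hf.sub hg
  refine ⟨n 0, fun x => ?_⟩
  have : n x = n 0 := PreconnectedSpace.constant inferInstance hc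
  rw [← this, ← hn]; ring

theorem isLiftSystem_of_isOPC1Lift {G : Type*} [Group G]
    {ρ : G →* (UnitAddCircle ≃ₜ UnitAddCircle)} {F : G → ℝ → ℝ}
    (hF : ∀ g, IsOPC1Lift (ρ g) (F g)) : IsLiftSystem F where
  contDiff g := (hF g).1
  deriv_pos g := (hF g).2.1
  add_one g := (hF g).2.2.1
  mul g h := by
    refine exists_int_of_coe_eq (hF _).1.continuous
      ((hF g).1.continuous.comp (hF h).1.continuous) fun x => ?_
    rw [← (hF (g * h)).2.2.2, map_mul, ← (hF g).2.2.2, ← (hF h).2.2.2]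
    rfl

namespace IsLiftSystem

variable {G : Type*} [Group G] {F : G → ℝ → ℝ}

theorem continuous (hF : IsLiftSystem F) (g : G) : Continuous (F g) := (hF.contDiff g).continuous

theorem differentiable (hF : IsLiftSystem F) (g : G) : Differentiable ℝ (F g) :=
  (hF.contDiff g).differentiable one_ne_zero

theorem continuous_deriv (hF : IsLiftSystem F) (g : G) : Continuous (deriv (F g)) :=
  (hF.contDiff g).continuous_deriv le_rfl

theorem strictMono (hF : IsLiftSystem F) (g : G) : StrictMono (F g) :=
  strictMono_of_deriv_pos (hF.deriv_pos g)

theorem add_int (hF : IsLiftSystem F) (g : G) (x : ℝ) (n : ℤ) : F g (x + n) = F g x + n := by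
  induction n using Int.induction_on with
  | zero => simp
  | succ n ih =>
    push_cast at ih ⊢
    rw [← add_assoc, hF.add_one, ih]; ring
  | pred n ih =>
    have := hF.add_one g (x + (-(n : ℤ) - 1 : ℤ))
    push_cast at this ih ⊢
    rw [show x + (-(n : ℝ) - 1) + 1 = x + -n by ring, ih] at this
    linarith

theorem deriv_add_int (hF : IsLiftSystem F)
    (g : G) (x : ℝ) (n : ℤ) : deriv (F g) (x + n) = deriv (F g) x := by
  rw [← deriv_comp_add_const]
  simp_rw [hF.add_int]
  simp

theorem deriv_add_one (hF : IsLiftSystem F)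
    (g : G) (x : ℝ) : deriv (F g) (x + 1) = deriv (F g) x := by
  simpa using hF.deriv_add_int g x 1

theorem deriv_mul (hF : IsLiftSystem F) (g h : G) (x : ℝ) :
    deriv (F (g * h)) x = deriv (F g) (F h x) * deriv (F h) x := by
  obtain ⟨n, hn⟩ := hF.mul g h
  rw [show F (g * h) = fun x => (F g ∘ F h) x + n from funext hn, deriv_add_const,
    deriv_comp _ (hF.differentiable g _) (hF.differentiable h _)]

theorem exists_one (hF : IsLiftSystem F) : ∃ n : ℤ, ∀ x, F 1 x = x + n := by
  obtain ⟨n, hn⟩ := hF.mul 1 1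
  refine ⟨-n, fun x => ?_⟩
  have := hn x
  rw [mul_one] at this
  have h2 : F 1 x = F 1 (F 1 x + n) := by rw [hF.add_int]; exact this
  have := (hF.strictMono 1).injective h2
  push_cast; linarith

theorem deriv_one (hF : IsLiftSystem F) (x : ℝ) : deriv (F 1) x = 1 := by
  obtain ⟨n, hn⟩ := hF.exists_one
  rw [funext hn]; simp

theorem deriv_inv_mul (hF : IsLiftSystem F)
    (g : G) (x : ℝ) : deriv (F g⁻¹) (F g x) * deriv (F g) x = 1 := by
  rw [← hF.deriv_mul, inv_mul_cancel, hF.deriv_one]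

theorem exists_deriv_eq (hF : IsLiftSystem F) (g : G) {x y : ℝ} (hxy : x < y) :
    ∃ z ∈ Set.Icc x y, F g y - F g x = deriv (F g) z * (y - x) := by
  obtain ⟨z, hz, h⟩ := exists_deriv_eq_slope (F g) hxy (hF.continuous g).continuousOn
    (hF.differentiable g).differentiableOn
  refine ⟨z, Set.Ioo_subset_Icc_self hz, ?_⟩
  rw [h, div_mul_cancel₀ _ (sub_pos.2 hxy).ne']

theorem exists_deriv_le (hF : IsLiftSystem F) (g : G) : ∃ L : ℝ, ∀ x, deriv (F g) x ≤ L := by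
  obtain ⟨L, hL⟩ := (isCompact_Icc (a := (0:ℝ)) (b := 1)).bddAbove_image
    (hF.continuous_deriv g).continuousOn
  refine ⟨L, fun x => ?_⟩
  rw [← Int.fract_add_floor x, hF.deriv_add_int]
  exact hL ⟨_, ⟨Int.fract_nonneg x, (Int.fract_lt_one x).le⟩, rfl⟩

theorem uniformContinuous_deriv (hF : IsLiftSystem F)
    (g : G) : UniformContinuous (deriv (F g)) := by
  have hper : Function.Periodic (deriv (F g)) 1 := hF.deriv_add_one g
  rw [Metric.uniformContinuous_iff]
  intro ε hε
  have hc := (isCompact_Icc (a := (-1:ℝ)) (b := 2)).uniformContinuousOn_of_continuous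
    (hF.continuous_deriv g).continuousOn
  rw [Metric.uniformContinuousOn_iff] at hc
  obtain ⟨δ, hδ, h⟩ := hc ε hε
  refine ⟨min δ 1, by positivity, fun x y hxy => ?_⟩
  have h0 := Int.fract_nonneg x
  have h1 := Int.fract_lt_one x
  have hxy' := hxy
  rw [Real.dist_eq, lt_min_iff, abs_lt, abs_lt] at hxy'
  have hfx : x = Int.fract x + ⌊x⌋ := (Int.fract_add_floor x).symm
  have hy : y = (y - ⌊x⌋) + ⌊x⌋ := by ring
  rw [hfx, hy, hF.deriv_add_int, hF.deriv_add_int]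
  have e : Int.fract x - (y - ⌊x⌋) = x - y := by rw [Int.fract]; ring
  refine h _ ⟨by linarith, by linarith⟩ _ ⟨by linarith [hxy'.2.2], by linarith [hxy'.2.1]⟩ ?_
  rw [Real.dist_eq, e, ← Real.dist_eq]
  exact lt_of_lt_of_le hxy (min_le_left _ _)

end IsLiftSystem

end LiftSystem

section RandomWalk

/-- The average of `Φ` over a finite set. -/
noncomputable def stepAvg {G : Type*} (S : Finset G) (Φ : G → ℝ) : ℝ :=
  (S.card : ℝ)⁻¹ * ∑ s ∈ S, Φ s

/-- The expectation of `Φ` at time `n` of the random walk on a group started at `1`, with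
increments uniformly distributed in `S`. -/
noncomputable def walkExp {G : Type*} [Group G] (S : Finset G) : ℕ → (G → ℝ) → ℝ
  | 0, Φ => Φ 1
  | n + 1, Φ => stepAvg S fun s => walkExp S n fun f => Φ (f * s)

variable {G : Type*} {S : Finset G}

theorem stepAvg_mono {Φ Ψ : G → ℝ} (h : ∀ s ∈ S, Φ s ≤ Ψ s) : stepAvg S Φ ≤ stepAvg S Ψ :=
  mul_le_mul_of_nonneg_left (Finset.sum_le_sum h) (by positivity)

theorem stepAvg_nonneg {Φ : G → ℝ} (h : ∀ s ∈ S, 0 ≤ Φ s) : 0 ≤ stepAvg S Φ :=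
  mul_nonneg (by positivity) (Finset.sum_nonneg h)

theorem stepAvg_const (hS : S.Nonempty) (a : ℝ) : stepAvg S (fun _ => a) = a := by
  have : (S.card : ℝ) ≠ 0 := by exact_mod_cast hS.card_pos.ne'
  simp [stepAvg, this]

theorem stepAvg_le (hS : S.Nonempty) {Φ : G → ℝ} {a : ℝ} (h : ∀ s ∈ S, Φ s ≤ a) :
    stepAvg S Φ ≤ a :=
  (stepAvg_mono h).trans (stepAvg_const hS a).le

theorem stepAvg_add (Φ Ψ : G → ℝ) :
    stepAvg S (fun s => Φ s + Ψ s) = stepAvg S Φ + stepAvg S Ψ := by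
  simp [stepAvg, Finset.sum_add_distrib, mul_add]

theorem stepAvg_mul_left (a : ℝ) (Φ : G → ℝ) :
    stepAvg S (fun s => a * Φ s) = a * stepAvg S Φ := by
  simp only [stepAvg, ← Finset.mul_sum]; ring

theorem stepAvg_sum {ι : Type*} (t : Finset ι) (Φ : ι → G → ℝ) :
    stepAvg S (fun s => ∑ i ∈ t, Φ i s) = ∑ i ∈ t, stepAvg S (Φ i) := by
  simp only [stepAvg, Finset.mul_sum]
  exact Finset.sum_comm

theorem stepAvg_sqrt_le {Φ : G → ℝ} (h : ∀ s ∈ S, 0 ≤ Φ s) :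
    stepAvg S (fun s => √(Φ s)) ≤ √(stepAvg S Φ) := by
  apply Real.le_sqrt_of_sq_le
  have h1 := sq_sum_le_card_mul_sum_sq (s := S) (f := fun s => √(Φ s))
  rw [Finset.sum_congr rfl fun s hs => Real.sq_sqrt (h s hs)] at h1
  rcases S.eq_empty_or_nonempty with rfl | hS
  · simp [stepAvg]
  have hc : (0 : ℝ) < S.card := by exact_mod_cast hS.card_pos
  rw [stepAvg, stepAvg, mul_pow, inv_pow, inv_mul_le_iff₀ (by positivity)]
  convert h1 using 1
  field_simp

variable [Group G]

theorem walkExp_mono {P : ℕ → G → Prop} (h1 : P 0 1)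
    (hs : ∀ n f, P n f → ∀ s ∈ S, P (n + 1) (f * s)) (n : ℕ) {Φ Ψ : G → ℝ}
    (h : ∀ f, P n f → Φ f ≤ Ψ f) : walkExp S n Φ ≤ walkExp S n Ψ := by
  induction n generalizing Φ Ψ with
  | zero => exact h 1 h1
  | succ n ih => exact stepAvg_mono fun s hs' => ih fun f hf => h _ (hs n f hf s hs')

theorem walkExp_mono' (n : ℕ) {Φ Ψ : G → ℝ} (h : ∀ f, Φ f ≤ Ψ f) :
    walkExp S n Φ ≤ walkExp S n Ψ :=
  walkExp_mono (P := fun _ _ => True) trivial (fun _ _ _ _ _ => trivial) n fun f _ => h f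

theorem walkExp_const (hS : S.Nonempty) (n : ℕ) (a : ℝ) : walkExp S n (fun _ => a) = a := by
  induction n with
  | zero => rfl
  | succ n ih => simp only [walkExp, ih, stepAvg_const hS]

theorem walkExp_add (n : ℕ) (Φ Ψ : G → ℝ) :
    walkExp S n (fun f => Φ f + Ψ f) = walkExp S n Φ + walkExp S n Ψ := by
  induction n generalizing Φ Ψ with
  | zero => rfl
  | succ n ih => simp only [walkExp, ih, stepAvg_add]

theorem walkExp_mul_left (n : ℕ) (a : ℝ) (Φ : G → ℝ) :
    walkExp S n (fun f => a * Φ f) = a * walkExp S n Φ := by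
  induction n generalizing Φ with
  | zero => rfl
  | succ n ih => simp only [walkExp, ih, stepAvg_mul_left]

theorem walkExp_sum {ι : Type*} (n : ℕ) (t : Finset ι) (Φ : ι → G → ℝ) :
    walkExp S n (fun f => ∑ i ∈ t, Φ i f) = ∑ i ∈ t, walkExp S n (Φ i) := by
  induction n generalizing Φ with
  | zero => rfl
  | succ n ih => simp only [walkExp, ih, stepAvg_sum]

theorem walkExp_time_add (n m : ℕ) (Φ : G → ℝ) :
    walkExp S (n + m) Φ = walkExp S n fun f => walkExp S m fun w => Φ (w * f) := by
  induction n generalizing Φ with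
  | zero => simp [walkExp]
  | succ n ih =>
    rw [Nat.add_right_comm]
    simp only [walkExp, ih, mul_assoc]

theorem walkExp_succ' (n : ℕ) (Φ : G → ℝ) :
    walkExp S (n + 1) Φ = walkExp S n fun f => stepAvg S fun s => Φ (s * f) := by
  rw [walkExp_time_add]
  simp [walkExp]

theorem walkExp_stepAvg (n : ℕ) (Φ : G → G → ℝ) :
    walkExp S n (fun f => stepAvg S fun s => Φ s f) = stepAvg S fun s => walkExp S n (Φ s) := by
  simp only [stepAvg, walkExp_mul_left, walkExp_sum]

theorem walkExp_inv (hS : ∀ s ∈ S, s⁻¹ ∈ S) (n : ℕ) (Φ : G → ℝ) :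
    walkExp S n (fun f => Φ f⁻¹) = walkExp S n Φ := by
  induction n generalizing Φ with
  | zero => simp [walkExp]
  | succ n ih =>
    rw [walkExp_succ', walkExp_stepAvg]
    simp only [walkExp, mul_inv_rev]
    simp only [stepAvg]
    congr 1
    refine Finset.sum_nbij' (·⁻¹) (·⁻¹) hS hS (by simp) (by simp) fun s _ => ?_
    exact ih fun f => Φ (f * s⁻¹)

end RandomWalk

section SpectralGap

/-- The half-density Markov operator `φ ↦ |S|⁻¹ ∑ₛ (F s)'^{1/2} φ ∘ F s`. -/
noncomputable def koopmanAvg {G : Type*} (F : G → ℝ → ℝ) (S : Finset G) (φ : ℝ → ℝ) (x : ℝ) : ℝ :=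
  stepAvg S fun s => √(deriv (F s) x) * φ (F s x)

theorem sq_stepAvg_add_le {G : Type*} {S : Finset G} (a : G → ℝ) {s t : G}
    (hs : s ∈ S) (ht : t ∈ S) :
    stepAvg S a ^ 2 + (2 * S.card : ℝ)⁻¹ * (a s - a t) ^ 2 ≤ stepAvg S fun s => a s ^ 2 := by
  classical
  have hc : (0 : ℝ) < S.card := by exact_mod_cast Finset.card_pos.2 ⟨s, hs⟩
  set m := stepAvg S a with hm
  have hsum : ∑ i ∈ S, a i = S.card * m := by rw [hm, stepAvg]; field_simp
  have hvar : ∑ i ∈ S, (a i - m) ^ 2 = ∑ i ∈ S, a i ^ 2 - S.card * m ^ 2 := by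
    simp only [sub_sq, Finset.sum_add_distrib, Finset.sum_sub_distrib, Finset.sum_const,
      nsmul_eq_mul, ← Finset.sum_mul, ← Finset.mul_sum, hsum]
    ring
  have hpair : (a s - a t) ^ 2 / 2 ≤ ∑ i ∈ S, (a i - m) ^ 2 := by
    by_cases hst : s = t
    · subst hst
      simp only [sub_self, ne_eq, OfNat.ofNat_ne_zero, not_false_eq_true, zero_pow, zero_div]
      positivity
    · have h1 : ∑ i ∈ ({s, t} : Finset G), (a i - m) ^ 2 ≤ ∑ i ∈ S, (a i - m) ^ 2 :=
        Finset.sum_le_sum_of_subset_of_nonneg (by simp [Finset.insert_subset_iff, hs, ht])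
          fun _ _ _ => by positivity
      rw [Finset.sum_pair hst] at h1
      nlinarith [sq_nonneg ((a s - m) + (a t - m))]
  rw [hvar] at hpair
  rw [stepAvg, mul_inv]
  have h3 : (S.card : ℝ)⁻¹ * ((a s - a t) ^ 2 / 2) ≤
      (S.card : ℝ)⁻¹ * (∑ i ∈ S, a i ^ 2 - S.card * m ^ 2) :=
    mul_le_mul_of_nonneg_left hpair (by positivity)
  rw [mul_sub, inv_mul_cancel_left₀ hc.ne'] at h3
  linarith

/-- The measure on the circle with density `w` with respect to Lebesgue measure. -/
noncomputable def circleDensity (w : ℝ → ℝ) : Measure UnitAddCircle :=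
  ((volume.restrict (Set.Ioc (0 : ℝ) 1)).withDensity fun x => ENNReal.ofReal (w x)).map
    ((↑) : ℝ → UnitAddCircle)

theorem measurable_coe_unitAddCircle : Measurable ((↑) : ℝ → UnitAddCircle) :=
  AddCircle.measurable_mk'

theorem integral_circleDensity {w : ℝ → ℝ} (hw : Continuous w) (h0 : ∀ x, 0 ≤ w x)
    {u : UnitAddCircle → ℝ} (hu : Continuous u) :
    ∫ p, u p ∂circleDensity w = ∫ x in (0 : ℝ)..1, w x * u (x : UnitAddCircle) := by
  rw [circleDensity, integral_map measurable_coe_unitAddCircle.aemeasurable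
    hu.aestronglyMeasurable, integral_withDensity_eq_integral_toReal_smul
    hw.measurable.ennreal_ofReal (by simp), intervalIntegral.integral_of_le zero_le_one]
  refine integral_congr_ae (Filter.Eventually.of_forall fun x => ?_)
  simp [ENNReal.toReal_ofReal (h0 x)]

theorem isProbabilityMeasure_circleDensity {w : ℝ → ℝ} (hw : Continuous w) (h0 : ∀ x, 0 ≤ w x)
    (h1 : ∫ x in (0 : ℝ)..1, w x = 1) : IsProbabilityMeasure (circleDensity w) := by
  constructor
  rw [circleDensity, Measure.map_apply measurable_coe_unitAddCircle MeasurableSet.univ,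
    Set.preimage_univ, withDensity_apply _ MeasurableSet.univ, Measure.restrict_univ,
    ← ofReal_integral_eq_lintegral_ofReal _ (Filter.Eventually.of_forall h0),
    ← intervalIntegral.integral_of_le zero_le_one, h1, ENNReal.ofReal_one]
  exact (hw.integrableOn_Icc (a := 0) (b := 1)).mono_set Set.Ioc_subset_Icc_self

variable {G : Type*} [Group G] {F : G → ℝ → ℝ}

theorem IsLiftSystem.integral_deriv_mul_comp (hF : IsLiftSystem F) (g : G) {ψ : ℝ → ℝ}
    (hψ : Continuous ψ) (hper : Function.Periodic ψ 1) :
    ∫ x in (0 : ℝ)..1, deriv (F g) x * ψ (F g x) = ∫ x in (0 : ℝ)..1, ψ x := by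
  have h := intervalIntegral.integral_comp_mul_deriv (a := 0) (b := 1) (f := F g)
    (f' := deriv (F g)) (g := ψ) (fun x _ => (hF.differentiable g x).hasDerivAt)
    (hF.continuous_deriv g).continuousOn hψ
  have e : F g 1 = F g 0 + 1 := by simpa using hF.add_one g 0
  rw [e, hper.intervalIntegral_add_eq (F g 0) 0, zero_add] at h
  rw [← h]
  simp only [Function.comp_apply, mul_comm]

theorem IsLiftSystem.continuous_halfDensity (hF : IsLiftSystem F) (g : G) {φ : ℝ → ℝ}
    (hφ : Continuous φ) : Continuous fun x => √(deriv (F g) x) * φ (F g x) :=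
  (hF.continuous_deriv g).sqrt.mul (hφ.comp (hF.continuous g))

theorem IsLiftSystem.continuous_koopmanAvg (hF : IsLiftSystem F) (S : Finset G) {φ : ℝ → ℝ}
    (hφ : Continuous φ) : Continuous (koopmanAvg F S φ) :=
  continuous_const.mul (continuous_finsetSum _ fun g _ => hF.continuous_halfDensity g hφ)

theorem IsLiftSystem.periodic_koopmanAvg (hF : IsLiftSystem F) (S : Finset G) {φ : ℝ → ℝ}
    (hper : Function.Periodic φ 1) : Function.Periodic (koopmanAvg F S φ) 1 := fun x => by
  simp only [koopmanAvg, hF.deriv_add_one, hF.add_one, hper _]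

theorem IsLiftSystem.integral_sq_koopmanAvg_add_le (hF : IsLiftSystem F) {S : Finset G} {s : G}
    (h1 : 1 ∈ S) (hs : s ∈ S) {φ : ℝ → ℝ} (hφ : Continuous φ) (hper : Function.Periodic φ 1) :
    (∫ x in (0 : ℝ)..1, koopmanAvg F S φ x ^ 2) + (2 * S.card : ℝ)⁻¹ *
      (∫ x in (0 : ℝ)..1, (√(deriv (F s) x) * φ (F s x) - φ x) ^ 2) ≤
      ∫ x in (0 : ℝ)..1, φ x ^ 2 := by
  have hc : (S.card : ℝ) ≠ 0 := by exact_mod_cast (Finset.card_pos.2 ⟨s, hs⟩).ne'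
  have hT := hF.continuous_koopmanAvg S hφ
  have hh := fun g => hF.continuous_halfDensity g hφ
  have hid : ∀ x, √(deriv (F 1) x) * φ (F 1 x) = φ x := fun x => by
    obtain ⟨n, hn⟩ := hF.exists_one
    rw [hF.deriv_one, hn, Real.sqrt_one, one_mul]
    simpa using (hper.int_mul n) x
  have hsq : ∀ g x, (√(deriv (F g) x) * φ (F g x)) ^ 2 = deriv (F g) x * φ (F g x) ^ 2 :=
    fun g x => by rw [mul_pow, Real.sq_sqrt (hF.deriv_pos g x).le]
  have hR : (∫ x in (0 : ℝ)..1, stepAvg S fun g => (√(deriv (F g) x) * φ (F g x)) ^ 2) =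
      ∫ x in (0 : ℝ)..1, φ x ^ 2 := by
    simp only [stepAvg]
    have hi : ∀ g ∈ S, IntervalIntegrable (fun x => (√(deriv (F g) x) * φ (F g x)) ^ 2)
      volume 0 1 := fun g _ => ((hh g).pow 2).intervalIntegrable _ _
    rw [intervalIntegral.integral_const_mul, intervalIntegral.integral_finsetSum hi]
    simp only [hsq]
    rw [Finset.sum_congr rfl fun g _ => hF.integral_deriv_mul_comp g (ψ := fun x => φ x ^ 2)
      (hφ.pow 2) (fun x => by simp only [hper x])]
    simp [hc]
  have hi1 : IntervalIntegrable (fun x => koopmanAvg F S φ x ^ 2) volume 0 1 :=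
    (hT.pow 2).intervalIntegrable _ _
  have hi2 : IntervalIntegrable (fun x => (2 * S.card : ℝ)⁻¹ *
      (√(deriv (F s) x) * φ (F s x) - φ x) ^ 2) volume 0 1 :=
    (continuous_const.mul (((hh s).sub hφ).pow 2)).intervalIntegrable _ _
  rw [← hR, ← intervalIntegral.integral_const_mul, ← intervalIntegral.integral_add hi1 hi2]
  refine intervalIntegral.integral_mono_on zero_le_one ?_ ?_ fun x _ => ?_
  · exact hi1.add hi2
  · exact (continuous_const.mul (continuous_finsetSum _ fun g _ =>
      (hh g).pow 2)).intervalIntegrable _ _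
  · have := sq_stepAvg_add_le (fun g => √(deriv (F g) x) * φ (F g x)) hs h1
    rw [hid] at this
    exact this

theorem IsLiftSystem.abs_integral_comp_sub_le (hF : IsLiftSystem F) (s : G) {φ u : ℝ → ℝ}
    (hφ : Continuous φ) (hper : Function.Periodic φ 1) (hu : Continuous u)
    (huper : Function.Periodic u 1) {C ε A : ℝ} (hC : ∀ x, |u x| ≤ C) (hε : 0 < ε)
    (hA : ∫ x in (0 : ℝ)..1, φ x ^ 2 = A)
    (hd : ∫ x in (0 : ℝ)..1, (√(deriv (F s) x) * φ (F s x) - φ x) ^ 2 ≤ ε ^ 2 / 4 * A) :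
    |(∫ x in (0 : ℝ)..1, φ x ^ 2 * u (F s x)) - ∫ x in (0 : ℝ)..1, φ x ^ 2 * u x| ≤
      C * ε * A := by
  have hC0 : 0 ≤ C := (abs_nonneg _).trans (hC 0)
  set ψ : ℝ → ℝ := fun x => √(deriv (F s) x) * φ (F s x) with hψ
  have hψc : Continuous ψ := hF.continuous_halfDensity s hφ
  have hsq : ∀ x, ψ x ^ 2 = deriv (F s) x * φ (F s x) ^ 2 :=
    fun x => by rw [hψ]; simp only; rw [mul_pow, Real.sq_sqrt (hF.deriv_pos s x).le]
  have hψA : ∫ x in (0 : ℝ)..1, ψ x ^ 2 = A := by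
    simp only [hsq]
    rw [hF.integral_deriv_mul_comp s (ψ := fun x => φ x ^ 2)
      (hφ.pow 2) (fun x => by simp only [hper x]), hA]
  have e : ∫ x in (0 : ℝ)..1, φ x ^ 2 * u x = ∫ x in (0 : ℝ)..1, ψ x ^ 2 * u (F s x) := by
    rw [← hF.integral_deriv_mul_comp s (ψ := fun x => φ x ^ 2 * u x)
      ((hφ.pow 2).mul hu) (fun x => by simp only [hper x, huper x])]
    simp only [hsq, mul_assoc]
  have huc := hu.comp (hF.continuous s)
  have hi1 : IntervalIntegrable (fun x => φ x ^ 2 * u (F s x)) volume 0 1 :=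
    ((hφ.pow 2).mul huc).intervalIntegrable _ _
  have hi2 : IntervalIntegrable (fun x => ψ x ^ 2 * u (F s x)) volume 0 1 :=
    ((hψc.pow 2).mul huc).intervalIntegrable _ _
  have hi3 : IntervalIntegrable (fun x => ψ x ^ 2) volume 0 1 :=
    (hψc.pow 2).intervalIntegrable _ _
  have hi4 : IntervalIntegrable (fun x => φ x ^ 2) volume 0 1 :=
    (hφ.pow 2).intervalIntegrable _ _
  rw [e, ← intervalIntegral.integral_sub hi1 hi2]
  have hb : ∀ x, ‖φ x ^ 2 * u (F s x) - ψ x ^ 2 * u (F s x)‖ ≤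
      C * (2 / ε * (ψ x - φ x) ^ 2 + ε / 4 * (ψ x ^ 2 + φ x ^ 2)) := by
    intro x
    rw [Real.norm_eq_abs, ← sub_mul, abs_mul, mul_comm]
    refine mul_le_mul (hC _) ?_ (abs_nonneg _) hC0
    have h1 : φ x ^ 2 - ψ x ^ 2 = -((ψ x - φ x) * (ψ x + φ x)) := by ring
    have h2 : |(ψ x - φ x) * (ψ x + φ x)| ≤
        2 / ε * (ψ x - φ x) ^ 2 + ε / 8 * (ψ x + φ x) ^ 2 := by
      have key : ∀ a b : ℝ, a * b ≤ 2 / ε * a ^ 2 + ε / 8 * b ^ 2 := by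
        intro a b
        have : 2 / ε * a ^ 2 + ε / 8 * b ^ 2 - a * b = 2 / ε * (a - ε / 4 * b) ^ 2 := by
          field_simp; ring
        have h : 0 ≤ 2 / ε * (a - ε / 4 * b) ^ 2 := by positivity
        linarith
      rw [abs_le]
      refine ⟨?_, key _ _⟩
      have := key (-(ψ x - φ x)) (ψ x + φ x)
      rw [neg_sq] at this
      linarith
    rw [h1, abs_neg]
    nlinarith [sq_nonneg (ψ x - φ x)]
  have hI1 : IntervalIntegrable (fun x => 2 / ε * (ψ x - φ x) ^ 2) volume 0 1 :=
    (continuous_const.mul ((hψc.sub hφ).pow 2)).intervalIntegrable _ _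
  have hI2 : IntervalIntegrable (fun x => ε / 4 * (ψ x ^ 2 + φ x ^ 2)) volume 0 1 :=
    (continuous_const.mul ((hψc.pow 2).add (hφ.pow 2))).intervalIntegrable _ _
  have h3 := intervalIntegral.norm_integral_le_of_norm_le zero_le_one
    (Filter.Eventually.of_forall fun x _ => hb x) ((hI1.add hI2).const_mul C)
  rw [intervalIntegral.integral_const_mul, intervalIntegral.integral_add hI1 hI2,
    intervalIntegral.integral_const_mul, intervalIntegral.integral_const_mul,
    intervalIntegral.integral_add hi3 hi4, hψA, hA, Real.norm_eq_abs] at h3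
  refine h3.trans ?_
  rw [mul_assoc]
  refine mul_le_mul_of_nonneg_left ?_ hC0
  calc _ ≤ 2 / ε * (ε ^ 2 / 4 * A) + ε / 4 * (A + A) := by gcongr
    _ = ε * A := by field_simp; ring

end SpectralGap

section InvariantMeasure

open scoped BoundedContinuousFunction in
theorem exists_invariant_of_almost_invariant {G X : Type*} [TopologicalSpace X] [T2Space X]
    [CompactSpace X] [MeasurableSpace X] [BorelSpace X] [HasOuterApproxClosed X] (f : G → X ≃ₜ X)
    (h : ∀ (T : Finset G) (ε : ℝ), 0 < ε → ε ≤ 1 → ∃ μ : Measure X, IsProbabilityMeasure μ ∧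
      ∀ s ∈ T, ∀ u : X →ᵇ ℝ, |(∫ p, u (f s p) ∂μ) - ∫ p, u p ∂μ| ≤ ‖u‖ * ε) :
    ∃ μ : Measure X, IsProbabilityMeasure μ ∧ ∀ g, μ.map (f g) = μ := by
  classical
  let K : G × ℕ × (X →ᵇ ℝ) → Set (ProbabilityMeasure X) := fun i =>
    {μ | |(∫ p, i.2.2 (f i.1 p) ∂(μ : Measure X)) - ∫ p, i.2.2 p ∂(μ : Measure X)| ≤
      ‖i.2.2‖ * (1 / (i.2.1 + 1 : ℝ))}
  have hK : ∀ i, IsClosed (K i) := fun i => by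
    have h1 := ProbabilityMeasure.continuous_integral_boundedContinuousFunction
      (i.2.2.compContinuous ⟨f i.1, (f i.1).continuous⟩)
    have h2 := ProbabilityMeasure.continuous_integral_boundedContinuousFunction i.2.2
    exact isClosed_le (h1.sub h2).abs continuous_const
  obtain ⟨μ, -, hμ⟩ := isCompact_univ.inter_iInter_nonempty K hK fun t => by
    set N := t.sup fun i => i.2.1 with hN
    obtain ⟨μ, hμ, hs⟩ := h (t.image Prod.fst) (1 / (N + 1 : ℝ)) (by positivity)
      (div_le_one_of_le₀ (by simp) (by positivity))
    refine ⟨⟨μ, hμ⟩, Set.mem_univ _, Set.mem_iInter₂.2 fun i hi => ?_⟩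
    refine (hs i.1 (Finset.mem_image_of_mem _ hi) i.2.2).trans ?_
    have : i.2.1 ≤ N := Finset.le_sup (f := fun i : G × ℕ × (X →ᵇ ℝ) => i.2.1) hi
    gcongr
  refine ⟨μ, inferInstance, fun g => ?_⟩
  have : IsProbabilityMeasure ((μ : Measure X).map (f g)) :=
    Measure.isProbabilityMeasure_map (f g).measurable.aemeasurable
  refine ext_of_forall_integral_eq_of_IsFiniteMeasure fun u => ?_
  rw [integral_map (f g).measurable.aemeasurable u.continuous.aestronglyMeasurable]
  have hb : ∀ n : ℕ, |(∫ p, u (f g p) ∂(μ : Measure X)) - ∫ p, u p ∂(μ : Measure X)| ≤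
      ‖u‖ * (1 / (n + 1 : ℝ)) := fun n => Set.mem_iInter.1 hμ (g, n, u)
  have hl := (tendsto_one_div_add_atTop_nhds_zero_nat (𝕜 := ℝ)).const_mul ‖u‖
  rw [mul_zero] at hl
  have := ge_of_tendsto' hl hb
  exact sub_eq_zero.1 (abs_eq_zero.1 (le_antisymm this (abs_nonneg _)))

end InvariantMeasure
section SpectralGap
variable {G : Type*} [Group G] {F : G → ℝ → ℝ}

theorem exists_koopmanAvg_gap (ρ : G →* (UnitAddCircle ≃ₜ UnitAddCircle))
    (hF : ∀ g : G, IsOPC1Lift (ρ g) (F g))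
    (hno : ¬ ∃ μ : Measure UnitAddCircle, IsProbabilityMeasure μ ∧
      ∀ g : G, Measure.map (ρ g) μ = μ) :
    ∃ S : Finset G, 1 ∈ S ∧ (∀ s ∈ S, s⁻¹ ∈ S) ∧ ∃ r : ℝ, 0 < r ∧ r < 1 ∧
      ∀ φ : ℝ → ℝ, Continuous φ → Function.Periodic φ 1 →
        ∫ x in (0 : ℝ)..1, koopmanAvg F S φ x ^ 2 ≤ r * ∫ x in (0 : ℝ)..1, φ x ^ 2 := by
  classical
  have hL := isLiftSystem_of_isOPC1Lift hF
  by_contra! hcon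
  refine hno (exists_invariant_of_almost_invariant (fun g => ρ g) fun T ε hε hε1 => ?_)
  set S : Finset G := insert 1 (T ∪ T.image (·⁻¹)) with hS
  have h1 : 1 ∈ S := by simp [hS]
  have hc : (1 : ℝ) ≤ S.card := by exact_mod_cast Finset.card_pos.2 ⟨1, h1⟩
  have hq : ε ^ 2 / (8 * S.card) < 1 := by
    rw [div_lt_one (by positivity)]; nlinarith
  have hq0 : 0 < ε ^ 2 / (8 * S.card) := by positivity
  obtain ⟨φ, hφ, hper, hlt⟩ := hcon S h1 (by
    intro s hs
    simp only [hS, Finset.mem_insert, Finset.mem_union, Finset.mem_image] at hs ⊢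
    rcases hs with rfl | hs | ⟨a, ha, rfl⟩
    · simp
    · exact .inr (.inr ⟨s, hs, rfl⟩)
    · simp [ha]) (1 - ε ^ 2 / (8 * S.card)) (by linarith) (by linarith)
  set A := ∫ x in (0 : ℝ)..1, φ x ^ 2 with hA
  have hA0 : 0 ≤ A := intervalIntegral.integral_nonneg zero_le_one fun _ _ => sq_nonneg _
  have hnn : ∀ s : G, 0 ≤ ∫ x in (0 : ℝ)..1, (√(deriv (F s) x) * φ (F s x) - φ x) ^ 2 :=
    fun s => intervalIntegral.integral_nonneg zero_le_one fun _ _ => sq_nonneg _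
  have hd : ∀ s ∈ S, ∫ x in (0 : ℝ)..1, (√(deriv (F s) x) * φ (F s x) - φ x) ^ 2 ≤
      ε ^ 2 / 4 * A := fun s hs => by
    have := hL.integral_sq_koopmanAvg_add_le h1 hs hφ hper
    rw [← hA] at this
    set I := ∫ x in (0 : ℝ)..1, (√(deriv (F s) x) * φ (F s x) - φ x) ^ 2
    have h3 : (2 * S.card : ℝ)⁻¹ * I ≤ ε ^ 2 / (8 * S.card) * A := by linarith
    calc I = (2 * S.card) * ((2 * S.card : ℝ)⁻¹ * I) := by field_simp
      _ ≤ (2 * S.card) * (ε ^ 2 / (8 * S.card) * A) := by gcongr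
      _ = _ := by field_simp; ring
  have hA1 : 0 < A := by
    refine lt_of_le_of_ne hA0 fun h0 => ?_
    have := hL.integral_sq_koopmanAvg_add_le h1 h1 hφ hper
    have h2 := hnn 1
    rw [← hA, ← h0] at this
    rw [← h0, mul_zero] at hlt
    have := mul_nonneg (inv_nonneg.2 (by linarith) : (0 : ℝ) ≤ (2 * S.card : ℝ)⁻¹) h2
    linarith
  have hw : Continuous fun x => φ x ^ 2 / A := (hφ.pow 2).div_const A
  have hw0 : ∀ x, 0 ≤ φ x ^ 2 / A := fun x => div_nonneg (sq_nonneg _) hA0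
  refine ⟨circleDensity fun x => φ x ^ 2 / A, isProbabilityMeasure_circleDensity hw hw0 ?_,
    fun s hs u => ?_⟩
  · rw [intervalIntegral.integral_div, ← hA, div_self hA1.ne']
  · rw [integral_circleDensity hw hw0 u.continuous,
      integral_circleDensity hw hw0 (u := fun p => u (ρ s p))
        (u.continuous.comp (ρ s).continuous)]
    have h := hL.abs_integral_comp_sub_le s hφ hper (u := fun x => u (x : UnitAddCircle))
      (u.continuous.comp (AddCircle.continuous_mk' 1)) (fun x => by simp only [AddCircle.coe_add_period])
      (C := ‖u‖)
      (fun x => u.norm_coe_le_norm _) hε hA.symm (hd s (by simp [hS, hs]))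
    have e : ∀ x : ℝ, ((F s x : ℝ) : UnitAddCircle) = ρ s x := fun x => ((hF s).2.2.2 x).symm
    simp only [div_mul_eq_mul_div, intervalIntegral.integral_div, e] at h ⊢
    rw [← sub_div, abs_div, abs_of_pos hA1, div_le_iff₀ hA1]
    exact h

end SpectralGap

section LocalContraction

/-- The constants used to follow short intervals under a random walk: `q` bounds the norm of the
half-density Markov operator, `c` the distortion of derivatives on intervals of length at most
`δ`, and `L` the derivatives of the generators. -/
structure WalkConstants {G : Type*} [Group G] (F : G → ℝ → ℝ) (S : Finset G) (q c L δ : ℝ) :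
    Prop where
  lift : IsLiftSystem F
  one_mem : 1 ∈ S
  inv_mem : ∀ s ∈ S, s⁻¹ ∈ S
  q_pos : 0 < q
  gap : ∀ φ : ℝ → ℝ, Continuous φ → Function.Periodic φ 1 →
    ∫ x in (0 : ℝ)..1, koopmanAvg F S φ x ^ 2 ≤ q ^ 2 * ∫ x in (0 : ℝ)..1, φ x ^ 2
  one_lt_c : 1 < c
  c_sq_mul_q : c ^ 2 * q < 1
  one_le_L : 1 ≤ L
  deriv_le : ∀ s ∈ S, ∀ x, deriv (F s) x ≤ L
  δ_pos : 0 < δ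
  δ_le_one : δ ≤ 1
  distortion : ∀ s ∈ S, ∀ x z, |x - z| ≤ δ → deriv (F s) z ≤ c ^ 2 * deriv (F s) x

theorem koopmanAvg_iterate_nonneg {α : Type*} (F : α → ℝ → ℝ) (S : Finset α) (k : ℕ)
    (x : ℝ) : 0 ≤ (koopmanAvg F S)^[k] (fun _ => 1) x := by
  induction k generalizing x with
  | zero => exact zero_le_one
  | succ k ih =>
    rw [Function.iterate_succ_apply']
    exact stepAvg_nonneg fun s _ => mul_nonneg (Real.sqrt_nonneg _) (ih _)

variable {G : Type*} [Group G] {F : G → ℝ → ℝ}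

theorem IsLiftSystem.exists_pos_le_deriv (hF : IsLiftSystem F) (g : G) :
    ∃ a : ℝ, 0 < a ∧ ∀ x, a ≤ deriv (F g) x := by
  obtain ⟨L, hL⟩ := hF.exists_deriv_le g⁻¹
  have hL0 : 0 < L := (hF.deriv_pos g⁻¹ 0).trans_le (hL 0)
  refine ⟨L⁻¹, by positivity, fun x => ?_⟩
  rw [eq_inv_of_mul_eq_one_right (hF.deriv_inv_mul g x)]
  exact inv_anti₀ (hF.deriv_pos _ _) (hL _)

theorem IsLiftSystem.exists_distortion (hF : IsLiftSystem F) (g : G) {C : ℝ} (hC : 1 < C) :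
    ∃ δ : ℝ, 0 < δ ∧ ∀ x z, |x - z| ≤ δ → deriv (F g) z ≤ C * deriv (F g) x := by
  obtain ⟨a, ha, hle⟩ := hF.exists_pos_le_deriv g
  obtain ⟨δ, hδ, h⟩ := Metric.uniformContinuous_iff.1 (hF.uniformContinuous_deriv g)
    ((C - 1) * a) (mul_pos (by linarith) ha)
  refine ⟨δ / 2, by positivity, fun x z hxz => ?_⟩
  have h1 := h (a := x) (b := z) (by rw [Real.dist_eq]; linarith)
  rw [Real.dist_eq, abs_lt] at h1
  nlinarith [hle x]

theorem exists_pos_forall_mem {α : Type*} (S : Finset α) {p : α → ℝ → Prop}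
    (h : ∀ s ∈ S, ∃ δ : ℝ, 0 < δ ∧ ∀ ε, 0 < ε → ε ≤ δ → p s ε) :
    ∃ δ : ℝ, 0 < δ ∧ δ ≤ 1 ∧ ∀ s ∈ S, p s δ := by
  have : ∀ᶠ ε in nhdsWithin (0 : ℝ) (Set.Ioi 0), ∀ s ∈ S, p s ε := by
    refine (Filter.eventually_all_finset S).2 fun s hs => ?_
    obtain ⟨δ, hδ, hp⟩ := h s hs
    filter_upwards [Ioc_mem_nhdsGT hδ] with ε hε using hp ε hε.1 hε.2
  obtain ⟨ε, h1, h2⟩ := (this.and (Ioc_mem_nhdsGT (zero_lt_one (α := ℝ)))).exists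
  exact ⟨ε, h2.1, h2.2, h1⟩

theorem exists_walkConstants (ρ : G →* (UnitAddCircle ≃ₜ UnitAddCircle))
    (hF : ∀ g : G, IsOPC1Lift (ρ g) (F g))
    (hno : ¬ ∃ μ : Measure UnitAddCircle, IsProbabilityMeasure μ ∧
      ∀ g : G, Measure.map (ρ g) μ = μ) :
    ∃ (S : Finset G) (q c L δ : ℝ), WalkConstants F S q c L δ := by
  have hL := isLiftSystem_of_isOPC1Lift hF
  obtain ⟨S, h1, hinv, r, hr0, hr1, hgap⟩ := exists_koopmanAvg_gap ρ hF hno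
  have hq0 : 0 < √r := Real.sqrt_pos.2 hr0
  have hq1 : √r < 1 := by rw [Real.sqrt_lt' one_pos]; simpa using hr1
  obtain ⟨c2, hc1, hc2⟩ := exists_between ((one_lt_inv₀ hq0).2 hq1)
  have hc0 : 0 < c2 := by linarith
  choose! b hb using fun g => hL.exists_deriv_le g
  obtain ⟨L, hL'⟩ := (S.image b).bddAbove
  obtain ⟨δ, hδ, hδ1, hd⟩ := exists_pos_forall_mem S
    (p := fun s δ => ∀ x z, |x - z| ≤ δ → deriv (F s) z ≤ c2 * deriv (F s) x) fun s _ => by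
      obtain ⟨δ, hδ, h⟩ := hL.exists_distortion s hc1
      exact ⟨δ, hδ, fun ε _ hεδ x z hxz => h x z (hxz.trans hεδ)⟩
  refine ⟨S, √r, √c2, max 1 L, δ, ⟨hL, h1, hinv, hq0, ?_, ?_, ?_, le_max_left _ _, ?_, hδ, hδ1, ?_⟩⟩
  · rwa [Real.sq_sqrt hr0.le]
  · exact Real.lt_sqrt_of_sq_lt (by simpa using hc1)
  · rw [Real.sq_sqrt hc0.le]
    calc c2 * √r < (√r)⁻¹ * √r := by gcongr
      _ = 1 := inv_mul_cancel₀ hq0.ne'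
  · exact fun s hs x =>
      ((hb s x).trans (hL' (by simpa using ⟨s, hs, rfl⟩))).trans (le_max_right _ _)
  · rwa [Real.sq_sqrt hc0.le]

/-- The expected square root of the length of the image of `[x, y]` after `k` steps of the walk,
on the event that its length has never exceeded `δ`. -/
noncomputable def shortMass (F : G → ℝ → ℝ) (S : Finset G) (δ : ℝ) : ℕ → ℝ → ℝ → ℝ
  | 0, x, y => if y - x ≤ δ then √(y - x) else 0
  | k + 1, x, y => if y - x ≤ δ then stepAvg S fun s => shortMass F S δ k (F s x) (F s y) else 0

/-- The probability that the length of the image of `[x, y]` exceeds `δ` for the first time after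
exactly `k` steps of the walk. -/
noncomputable def exitProb (F : G → ℝ → ℝ) (S : Finset G) (δ : ℝ) : ℕ → ℝ → ℝ → ℝ
  | 0, x, y => if y - x ≤ δ then 0 else 1
  | k + 1, x, y => if y - x ≤ δ then stepAvg S fun s => exitProb F S δ k (F s x) (F s y) else 0

/-- The expectation of `c` to the power the exit time. -/
noncomputable def exitWeight (F : G → ℝ → ℝ) (S : Finset G) (c δ x y : ℝ) : ℝ :=
  ∑' k, c ^ k * exitProb F S δ k x y

/-- The truth value of a proposition, as a real number. -/
noncomputable def truthValue (p : Prop) : ℝ := open Classical in if p then 1 else 0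

theorem truthValue_nonneg (p : Prop) : 0 ≤ truthValue p := by
  unfold truthValue; split_ifs <;> norm_num

theorem truthValue_le {p : Prop} {a : ℝ} (h0 : 0 ≤ a) (h : p → 1 ≤ a) : truthValue p ≤ a := by
  unfold truthValue; split_ifs with hp
  exacts [h hp, h0]

theorem truthValue_of {p : Prop} (h : p) : truthValue p = 1 := if_pos h

theorem truthValue_mono {p q : Prop} (h : p → q) : truthValue p ≤ truthValue q :=
  truthValue_le (truthValue_nonneg _) fun hp => (truthValue_of (h hp)).ge

theorem truthValue_le_one (p : Prop) : truthValue p ≤ 1 := truthValue_le zero_le_one fun _ => le_rfl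

namespace WalkConstants

variable {S : Finset G} {q c L δ : ℝ}

theorem nonempty (hW : WalkConstants F S q c L δ) : S.Nonempty := ⟨1, hW.one_mem⟩

theorem c_pos (hW : WalkConstants F S q c L δ) : 0 < c := one_pos.trans hW.one_lt_c

theorem c_mul_q_pos (hW : WalkConstants F S q c L δ) : 0 < c * q := mul_pos hW.c_pos hW.q_pos

theorem L_pos (hW : WalkConstants F S q c L δ) : 0 < L := one_pos.trans_le hW.one_le_L

theorem len_le (hW : WalkConstants F S q c L δ)
    {s : G} (hs : s ∈ S) {x y z : ℝ} (hxy : x < y) (hd : y - x ≤ δ)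
    (hz : z ∈ Set.Icc x y) : F s y - F s x ≤ c ^ 2 * deriv (F s) z * (y - x) := by
  obtain ⟨w, hw, e⟩ := hW.lift.exists_deriv_eq s hxy
  rw [e]
  refine mul_le_mul_of_nonneg_right (hW.distortion s hs z w ?_) (by linarith)
  rw [abs_le]; constructor <;> linarith [hz.1, hz.2, hw.1, hw.2]

theorem deriv_mul_len_le (hW : WalkConstants F S q c L δ)
    {s : G} (hs : s ∈ S) {x y z : ℝ} (hxy : x < y) (hd : y - x ≤ δ)
    (hz : z ∈ Set.Icc x y) : deriv (F s) z * (y - x) ≤ c ^ 2 * (F s y - F s x) := by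
  obtain ⟨w, hw, e⟩ := hW.lift.exists_deriv_eq s hxy
  rw [e, ← mul_assoc]
  refine mul_le_mul_of_nonneg_right (hW.distortion s hs w z ?_) (by linarith)
  rw [abs_le]; constructor <;> linarith [hz.1, hz.2, hw.1, hw.2]

theorem continuous_iterate (hW : WalkConstants F S q c L δ)
    (k : ℕ) : Continuous ((koopmanAvg F S)^[k] fun _ => 1) := by
  induction k with
  | zero => exact continuous_const
  | succ k ih => rw [Function.iterate_succ_apply']; exact hW.lift.continuous_koopmanAvg S ih

theorem periodic_iterate (hW : WalkConstants F S q c L δ)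
    (k : ℕ) : Function.Periodic ((koopmanAvg F S)^[k] fun _ => 1) 1 := by
  induction k with
  | zero => exact fun _ => rfl
  | succ k ih => rw [Function.iterate_succ_apply']; exact hW.lift.periodic_koopmanAvg S ih

theorem integral_sq_iterate_le (hW : WalkConstants F S q c L δ) (k : ℕ) :
    ∫ x in (0 : ℝ)..1, ((koopmanAvg F S)^[k] fun _ => 1) x ^ 2 ≤ q ^ (2 * k) := by
  induction k with
  | zero => simp
  | succ k ih =>
    rw [Function.iterate_succ_apply']
    refine (hW.gap _ (hW.continuous_iterate k) (hW.periodic_iterate k)).trans ?_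
    calc _ ≤ q ^ 2 * q ^ (2 * k) := by gcongr
      _ = _ := by ring

theorem integral_iterate_le (hW : WalkConstants F S q c L δ)
    (k : ℕ) {x y : ℝ} (hxy : x < y) (h1 : y - x ≤ 1) :
    ∫ z in x..y, ((koopmanAvg F S)^[k] fun _ => 1) z ≤ √(y - x) * q ^ k := by
  set R : ℝ → ℝ := (koopmanAvg F S)^[k] fun _ => 1 with hR
  have hRc : Continuous R := hW.continuous_iterate k
  have hd : 0 < √(y - x) := Real.sqrt_pos.2 (by linarith)
  have hdd : √(y - x) * √(y - x) = y - x := Real.mul_self_sqrt (by linarith)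
  set d := √(y - x)
  have hq : 0 < q ^ k := pow_pos hW.q_pos k
  set l := q ^ k / d with hl
  have hl0 : 0 < l := by positivity
  have h2 : ∫ z in x..y, R z ^ 2 ≤ q ^ (2 * k) := by
    refine le_trans ?_ (hW.integral_sq_iterate_le k)
    have hper : Function.Periodic (fun z => R z ^ 2) 1 :=
      fun z => by simp only [hR, hW.periodic_iterate k z]
    have := hper.intervalIntegral_add_eq x 0
    rw [zero_add] at this
    rw [← hR, ← this]
    refine intervalIntegral.integral_mono_interval le_rfl hxy.le (by linarith)
      (Filter.Eventually.of_forall fun z => sq_nonneg _) ((hRc.pow 2).intervalIntegrable _ _)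
  have hi : IntervalIntegrable (fun z => R z ^ 2) volume x y := (hRc.pow 2).intervalIntegrable _ _
  have hi2 : IntervalIntegrable (fun z => l⁻¹ / 2 * R z ^ 2) volume x y := hi.const_mul _
  calc ∫ z in x..y, R z ≤ ∫ z in x..y, (l / 2 + l⁻¹ / 2 * R z ^ 2) := by
        refine intervalIntegral.integral_mono_on hxy.le (hRc.intervalIntegrable _ _)
          (intervalIntegrable_const.add hi2) fun z _ => ?_
        have : l / 2 + l⁻¹ / 2 * R z ^ 2 - R z = l⁻¹ / 2 * (R z - l) ^ 2 := by
          field_simp; ring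
        have h : 0 ≤ l⁻¹ / 2 * (R z - l) ^ 2 := by positivity
        linarith
    _ = (y - x) * (l / 2) + l⁻¹ / 2 * ∫ z in x..y, R z ^ 2 := by
        rw [intervalIntegral.integral_add intervalIntegrable_const hi2,
          intervalIntegral.integral_const, intervalIntegral.integral_const_mul, smul_eq_mul]
    _ ≤ (y - x) * (l / 2) + l⁻¹ / 2 * q ^ (2 * k) := by gcongr
    _ = d * q ^ k := by
        rw [← hdd, hl, pow_mul', sq]
        field_simp; ring

end WalkConstants
end LocalContraction

section ExitWeight

variable {G : Type*} [Group G] {F : G → ℝ → ℝ}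

theorem shortMass_nonneg {α : Type*} (F : α → ℝ → ℝ) (S : Finset α) (δ : ℝ) (k : ℕ) (x y : ℝ) :
    0 ≤ shortMass F S δ k x y := by
  induction k generalizing x y with
  | zero => unfold shortMass; split_ifs <;> positivity
  | succ k ih =>
    unfold shortMass; split_ifs
    exacts [stepAvg_nonneg fun s _ => ih _ _, le_rfl]

theorem exitProb_nonneg {α : Type*} (F : α → ℝ → ℝ) (S : Finset α) (δ : ℝ) (k : ℕ) (x y : ℝ) :
    0 ≤ exitProb F S δ k x y := by
  induction k generalizing x y with
  | zero => unfold exitProb; split_ifs <;> positivity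
  | succ k ih =>
    unfold exitProb; split_ifs
    exacts [stepAvg_nonneg fun s _ => ih _ _, le_rfl]

theorem IsLiftSystem.exitProb_add_int (hF : IsLiftSystem F) (S : Finset G) (δ : ℝ) (k : ℕ)
    (x y : ℝ) (n : ℤ) : exitProb F S δ k (x + n) (y + n) = exitProb F S δ k x y := by
  induction k generalizing x y with
  | zero => simp only [exitProb, add_sub_add_right_eq_sub]
  | succ k ih => simp only [exitProb, add_sub_add_right_eq_sub, hF.add_int, ih]

theorem IsLiftSystem.exitWeight_add_int (hF : IsLiftSystem F) (S : Finset G) (c δ x y : ℝ) (n : ℤ) :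
    exitWeight F S c δ (x + n) (y + n) = exitWeight F S c δ x y := by
  simp only [exitWeight, hF.exitProb_add_int]

namespace WalkConstants

variable {S : Finset G} {q c L δ : ℝ}

theorem shortMass_le_iterate (hW : WalkConstants F S q c L δ)
    (k : ℕ) {x y z : ℝ} (hxy : x < y) (hz : z ∈ Set.Icc x y) :
    shortMass F S δ k x y ≤ √(y - x) * c ^ k * (koopmanAvg F S)^[k] (fun _ => 1) z := by
  have hc := hW.c_pos
  have h0 := koopmanAvg_iterate_nonneg F S
  induction k generalizing x y z with
  | zero =>
    unfold shortMass; split_ifs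
    · simp
    · simp
  | succ k ih =>
    unfold shortMass; split_ifs with hd
    · rw [Function.iterate_succ_apply', koopmanAvg, ← stepAvg_mul_left]
      refine stepAvg_mono fun s hs => ?_
      have hm := (hW.lift.strictMono s)
      refine (ih (hm hxy) ⟨hm.monotone hz.1, hm.monotone hz.2⟩).trans ?_
      have h1 : √(F s y - F s x) ≤ c * √(deriv (F s) z) * √(y - x) := by
        calc √(F s y - F s x) ≤ √(c ^ 2 * deriv (F s) z * (y - x)) :=
              Real.sqrt_le_sqrt (hW.len_le hs hxy hd hz)
          _ = _ := by
            rw [Real.sqrt_mul (by have := hW.lift.deriv_pos s z; positivity),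
              Real.sqrt_mul (by positivity), Real.sqrt_sq hc.le]
      calc √(F s y - F s x) * c ^ k * (koopmanAvg F S)^[k] (fun _ => 1) (F s z)
          ≤ (c * √(deriv (F s) z) * √(y - x)) * c ^ k *
            (koopmanAvg F S)^[k] (fun _ => 1) (F s z) := by
              have := h0 k (F s z)
              gcongr
        _ = _ := by ring
    · have := h0 (k + 1) z
      positivity

theorem shortMass_le (hW : WalkConstants F S q c L δ)
    (k : ℕ) {x y : ℝ} (hxy : x < y) : shortMass F S δ k x y ≤ (c * q) ^ k := by
  have hcq := hW.c_mul_q_pos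
  by_cases hd : y - x ≤ δ
  · have h1 : ∫ _ in x..y, shortMass F S δ k x y ≤
        ∫ z in x..y, √(y - x) * c ^ k * (koopmanAvg F S)^[k] (fun _ => 1) z :=
      intervalIntegral.integral_mono_on hxy.le intervalIntegrable_const
        ((continuous_const.mul (hW.continuous_iterate k)).intervalIntegrable _ _)
        fun z hz => hW.shortMass_le_iterate k hxy hz
    rw [intervalIntegral.integral_const, intervalIntegral.integral_const_mul, smul_eq_mul] at h1
    have h2 := hW.integral_iterate_le k hxy (hd.trans hW.δ_le_one)
    have hc : 0 < c ^ k := pow_pos hW.c_pos k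
    have h3 : √(y - x) * c ^ k * ∫ z in x..y, (koopmanAvg F S)^[k] (fun _ => 1) z ≤
        (y - x) * (c * q) ^ k := by
      calc _ ≤ √(y - x) * c ^ k * (√(y - x) * q ^ k) := by gcongr
        _ = (√(y - x) * √(y - x)) * (c * q) ^ k := by ring
        _ = _ := by rw [Real.mul_self_sqrt (by linarith)]
    exact le_of_mul_le_mul_left (h1.trans h3) (by linarith)
  · have : shortMass F S δ k x y = 0 := by cases k <;> simp [shortMass, hd]
    rw [this]; positivity

theorem len_le_L (hW : WalkConstants F S q c L δ) {s : G} (hs : s ∈ S) {x y : ℝ} (hxy : x < y) :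
    F s y - F s x ≤ L * (y - x) := by
  obtain ⟨w, -, e⟩ := hW.lift.exists_deriv_eq s hxy
  rw [e]
  exact mul_le_mul_of_nonneg_right (hW.deriv_le s hs w) (by linarith)

theorem exitProb_succ_le_shortMass (hW : WalkConstants F S q c L δ)
    (k : ℕ) {x y : ℝ} (hxy : x < y) :
    exitProb F S δ (k + 1) x y ≤ √(L / δ) * shortMass F S δ k x y := by
  have hδ := hW.δ_pos
  induction k generalizing x y with
  | zero =>
    simp only [exitProb, shortMass]
    split_ifs with hd
    · refine stepAvg_le hW.nonempty fun s hs => ?_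
      split_ifs with h
      · positivity
      · rw [← Real.sqrt_mul (div_nonneg hW.L_pos.le hδ.le), Real.one_le_sqrt,
          div_mul_eq_mul_div, one_le_div hδ]
        exact (not_le.1 h).le.trans (hW.len_le_L hs hxy)
    · simp
  | succ k ih =>
    rw [exitProb, shortMass]
    split_ifs with hd
    · rw [← stepAvg_mul_left]
      exact stepAvg_mono fun s _ => ih (hW.lift.strictMono s hxy)
    · simp

theorem pow_mul_exitProb_succ_le (hW : WalkConstants F S q c L δ) (k : ℕ) {x y : ℝ} (hxy : x < y) :
    c ^ (k + 1) * exitProb F S δ (k + 1) x y ≤ c * √(L / δ) * (c ^ 2 * q) ^ k := by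
  have hc := hW.c_pos
  calc _ ≤ c ^ (k + 1) * (√(L / δ) * (c * q) ^ k) := by
        gcongr
        refine (hW.exitProb_succ_le_shortMass k hxy).trans ?_
        gcongr
        exact hW.shortMass_le k hxy
    _ = _ := by ring

theorem c_sq_mul_q_nonneg (hW : WalkConstants F S q c L δ)
    : 0 ≤ c ^ 2 * q := mul_nonneg (sq_nonneg _) hW.q_pos.le

theorem summable_exitWeight (hW : WalkConstants F S q c L δ) {x y : ℝ} (hxy : x < y) :
    Summable fun k => c ^ k * exitProb F S δ k x y := by
  rw [← summable_nat_add_iff 1]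
  refine Summable.of_nonneg_of_le
    (fun k => mul_nonneg (pow_nonneg hW.c_pos.le _) (exitProb_nonneg ..))
    (fun k => hW.pow_mul_exitProb_succ_le k hxy) ?_
  exact (summable_geometric_of_lt_one hW.c_sq_mul_q_nonneg hW.c_sq_mul_q).mul_left _

theorem exitWeight_nonneg (hW : WalkConstants F S q c L δ) (x y : ℝ) : 0 ≤ exitWeight F S c δ x y :=
  tsum_nonneg fun _ => mul_nonneg (pow_nonneg hW.c_pos.le _) (exitProb_nonneg ..)

theorem exists_exitWeight_le (hW : WalkConstants F S q c L δ)
    : ∃ B : ℝ, ∀ x y, x < y → exitWeight F S c δ x y ≤ B := by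
  refine ⟨1 + ∑' k, c * √(L / δ) * (c ^ 2 * q) ^ k, fun x y hxy => ?_⟩
  rw [exitWeight, (hW.summable_exitWeight hxy).tsum_eq_zero_add]
  refine add_le_add ?_ (Summable.tsum_le_tsum (fun _ => hW.pow_mul_exitProb_succ_le _ hxy)
    ((summable_nat_add_iff 1).2 (hW.summable_exitWeight hxy))
    ((summable_geometric_of_lt_one hW.c_sq_mul_q_nonneg hW.c_sq_mul_q).mul_left _))
  simp only [exitProb, pow_zero, one_mul]
  split_ifs <;> norm_num

theorem sum_exitProb_le_exitWeight (hW : WalkConstants F S q c L δ)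
    (m : ℕ) {x y : ℝ} (hxy : x < y) :
    ∑ k ∈ Finset.range m, exitProb F S δ k x y ≤ exitWeight F S c δ x y := by
  refine le_trans (Finset.sum_le_sum fun k _ => ?_)
    ((hW.summable_exitWeight hxy).sum_le_tsum (Finset.range m) fun k _ =>
      mul_nonneg (pow_nonneg hW.c_pos.le _) (exitProb_nonneg ..))
  exact le_mul_of_one_le_left (exitProb_nonneg ..) (one_le_pow₀ hW.one_lt_c.le)

theorem one_le_exitWeight (hW : WalkConstants F S q c L δ)
    {x y : ℝ} (hxy : x < y) (hd : δ < y - x) :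
    1 ≤ exitWeight F S c δ x y := by
  simpa [exitProb, not_le.2 hd] using hW.sum_exitProb_le_exitWeight 1 hxy

theorem stepAvg_exitWeight (hW : WalkConstants F S q c L δ)
    {x y : ℝ} (hxy : x < y) (hd : y - x ≤ δ) :
    (stepAvg S fun s => exitWeight F S c δ (F s x) (F s y)) = c⁻¹ * exitWeight F S c δ x y := by
  have hs := fun s => hW.summable_exitWeight (hW.lift.strictMono s hxy)
  have e : ∀ k, c ^ (k + 1) * exitProb F S δ (k + 1) x y =
      c * stepAvg S fun s => c ^ k * exitProb F S δ k (F s x) (F s y) := fun k => by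
    rw [exitProb, if_pos hd, stepAvg_mul_left]; ring
  rw [exitWeight, (hW.summable_exitWeight hxy).tsum_eq_zero_add]
  simp only [e]
  rw [tsum_mul_left]
  simp only [stepAvg, exitWeight]
  rw [tsum_mul_left, Summable.tsum_finsetSum fun s _ => hs s]
  simp only [exitProb, if_pos hd, mul_zero, zero_add]
  rw [inv_mul_cancel_left₀ hW.c_pos.ne']

theorem walkExp_large_deriv_le (hW : WalkConstants F S q c L δ)
    (m : ℕ) {t : ℝ} (ht : 0 < t) {x y : ℝ} (hxy : x < y)
    (hd : y - x ≤ δ) :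
    (walkExp S m fun f => truthValue (∃ z ∈ Set.Icc x y,
      c ^ (2 * m) * t / (y - x) < deriv (F f) z)) ≤
      (√t)⁻¹ * shortMass F S δ m x y +
        ∑ k ∈ Finset.range m, exitProb F S δ (k + 1) x y := by
  have hc := hW.c_pos
  induction m generalizing x y with
  | zero =>
    have hl : 0 < y - x := by linarith
    simp only [walkExp, shortMass, if_pos hd, hW.lift.deriv_one, Finset.range_zero,
      Finset.sum_empty, add_zero, mul_zero, pow_zero, one_mul]
    refine truthValue_le (by positivity) ?_
    rintro ⟨z, -, h⟩
    rw [div_lt_one hl] at h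
    rw [inv_mul_eq_div, one_le_div (by positivity)]
    exact Real.sqrt_le_sqrt h.le
  | succ m ih =>
    have hl : 0 < y - x := by linarith
    rw [walkExp, shortMass, if_pos hd, ← stepAvg_mul_left]
    simp only [exitProb, if_pos hd]
    rw [← stepAvg_sum, ← stepAvg_add]
    refine stepAvg_mono fun s hs => ?_
    have hm := hW.lift.strictMono s
    have hls : 0 < F s y - F s x := sub_pos.2 (hm hxy)
    by_cases hds : F s y - F s x ≤ δ
    · rw [Finset.sum_range_succ']
      refine (walkExp_mono' m fun f => truthValue_mono ?_).trans
        ((ih (hm hxy) hds).trans (by simp [exitProb, hds]))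
      rintro ⟨z, hz, h⟩
      refine ⟨F s z, ⟨hm.monotone hz.1, hm.monotone hz.2⟩, ?_⟩
      rw [hW.lift.deriv_mul, div_lt_iff₀ hl] at h
      rw [div_lt_iff₀ hls]
      have h1 := hW.deriv_mul_len_le hs hxy hd hz
      have h2 := mul_le_mul_of_nonneg_left h1 (hW.lift.deriv_pos f (F s z)).le
      have h3 : c ^ 2 * (c ^ (2 * m) * t) < c ^ 2 * (deriv (F f) (F s z) * (F s y - F s x)) := by
        calc _ = c ^ (2 * (m + 1)) * t := by ring
          _ < _ := h
          _ ≤ deriv (F f) (F s z) * (c ^ 2 * (F s y - F s x)) := by rw [mul_assoc]; exact h2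
          _ = _ := by ring
      exact lt_of_mul_lt_mul_left h3 (by positivity)
    · have h1 : exitProb F S δ 0 (F s x) (F s y) = 1 := by simp [exitProb, hds]
      have h2 : exitProb F S δ 0 (F s x) (F s y) ≤
          ∑ i ∈ Finset.range (m + 1), exitProb F S δ i (F s x) (F s y) :=
        Finset.single_le_sum (fun i _ => exitProb_nonneg F S δ i _ _) (by simp)
      have h3 := mul_nonneg (inv_nonneg.2 (Real.sqrt_nonneg t))
        (shortMass_nonneg F S δ m (F s x) (F s y))
      refine (walkExp_mono' m fun f => truthValue_le_one _).trans ?_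
      rw [walkExp_const hW.nonempty]
      linarith

theorem sum_exitProb_succ_le_exitWeight (hW : WalkConstants F S q c L δ)
    (m : ℕ) {x y : ℝ} (hxy : x < y) :
    ∑ k ∈ Finset.range m, exitProb F S δ (k + 1) x y ≤ exitWeight F S c δ x y := by
  refine le_trans ?_ (hW.sum_exitProb_le_exitWeight (m + 1) hxy)
  rw [Finset.sum_range_succ']
  exact le_add_of_nonneg_right (exitProb_nonneg ..)

end WalkConstants
end ExitWeight

section Clustering

/-- All but at most `M` of the intervals `[j/N, (j+1)/N]`, `j < N`, consist of points where the
derivative of `f` is at most `t`. -/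
def ContractsOffArcs (f : ℝ → ℝ) (M N : ℕ) (t : ℝ) : Prop :=
  ∃ H : Finset ℕ, H.card ≤ M ∧ ∀ j < N, j ∉ H →
    ∀ z ∈ Set.Icc ((j : ℝ) / N) ((j + 1 : ℝ) / N), deriv f z ≤ t

/-- The sum over the intervals `[j/N, (j+1)/N]` of the square roots of the exit weights of their
images under `f`. -/
noncomputable def totalExitWeight {G : Type*} (F : G → ℝ → ℝ) (S : Finset G) (c δ : ℝ) (N : ℕ)
    (f : ℝ → ℝ) : ℝ :=
  ∑ j ∈ Finset.range N, √(exitWeight F S c δ (f ((j : ℝ) / N)) (f ((j + 1 : ℝ) / N)))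

variable {G : Type*} [Group G] {F : G → ℝ → ℝ}

theorem totalExitWeight_nonneg {α : Type*} (F : α → ℝ → ℝ) (S : Finset α) (c δ : ℝ) (N : ℕ)
    (f : ℝ → ℝ) : 0 ≤ totalExitWeight F S c δ N f :=
  Finset.sum_nonneg fun _ _ => Real.sqrt_nonneg _

theorem div_lt_succ_div {N : ℕ} (hN : 0 < N) (j : ℕ) : (j : ℝ) / N < (j + 1 : ℝ) / N := by
  have : (0 : ℝ) < N := by exact_mod_cast hN
  gcongr; linarith

theorem IsLiftSystem.sum_len (hF : IsLiftSystem F) (f : G) {N : ℕ} (hN : 0 < N) :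
    ∑ j ∈ Finset.range N, (F f ((j + 1 : ℝ) / N) - F f ((j : ℝ) / N)) = 1 := by
  have hN' : (N : ℝ) ≠ 0 := by exact_mod_cast hN.ne'
  have h := Finset.sum_range_sub (fun j : ℕ => F f ((j : ℝ) / N)) N
  push_cast at h
  rw [h, div_self hN', zero_div]
  have := hF.add_one f 0
  rw [zero_add] at this
  linarith

namespace WalkConstants

variable {S : Finset G} {q c L δ : ℝ}

theorem stepAvg_sqrt_exitWeight_le (hW : WalkConstants F S q c L δ)
    {B : ℝ} (hB : ∀ x y, x < y → exitWeight F S c δ x y ≤ B)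
    {x y : ℝ} (hxy : x < y) :
    (stepAvg S fun s => √(exitWeight F S c δ (F s x) (F s y))) ≤
      √c⁻¹ * √(exitWeight F S c δ x y) + √B / δ * (y - x) := by
  have hδ := hW.δ_pos
  have hl : 0 < y - x := by linarith
  have hc := hW.c_pos
  by_cases hd : y - x ≤ δ
  · refine (stepAvg_sqrt_le fun s _ => hW.exitWeight_nonneg _ _).trans ?_
    rw [hW.stepAvg_exitWeight hxy hd, Real.sqrt_mul (by positivity)]
    exact le_add_of_nonneg_right (by positivity)
  · refine (stepAvg_le hW.nonempty fun s _ =>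
      Real.sqrt_le_sqrt (hB _ _ (hW.lift.strictMono s hxy))).trans ?_
    refine le_trans ?_ (le_add_of_nonneg_left (by positivity))
    rw [div_mul_eq_mul_div, le_div_iff₀ hδ]
    exact mul_le_mul_of_nonneg_left (not_le.1 hd).le (Real.sqrt_nonneg _)

theorem stepAvg_totalExitWeight_le (hW : WalkConstants F S q c L δ)
    {B : ℝ} (hB : ∀ x y, x < y → exitWeight F S c δ x y ≤ B)
    {N : ℕ} (hN : 0 < N) (f : G) :
    (stepAvg S fun s => totalExitWeight F S c δ N (F (s * f))) ≤
      √c⁻¹ * totalExitWeight F S c δ N (F f) + √B / δ := by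
  have e : ∀ (s : G) (x y : ℝ), exitWeight F S c δ (F (s * f) x) (F (s * f) y) =
      exitWeight F S c δ (F s (F f x)) (F s (F f y)) := fun s x y => by
    obtain ⟨n, hn⟩ := hW.lift.mul s f
    rw [hn, hn, hW.lift.exitWeight_add_int]
  simp only [totalExitWeight, e]
  rw [stepAvg_sum, Finset.mul_sum]
  refine (Finset.sum_le_sum fun j _ => hW.stepAvg_sqrt_exitWeight_le hB
    (hW.lift.strictMono f (div_lt_succ_div hN j))).trans ?_
  rw [Finset.sum_add_distrib, ← Finset.mul_sum, ← Finset.mul_sum, hW.lift.sum_len f hN, mul_one]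

theorem exists_walkExp_totalExitWeight_le (hW : WalkConstants F S q c L δ)
    : ∃ K : ℝ, 1 ≤ K ∧ ∀ N : ℕ, 0 < N →
    ∃ n, (walkExp S n fun f => totalExitWeight F S c δ N (F f)) ≤ K := by
  obtain ⟨B, hB⟩ := hW.exists_exitWeight_le
  have hδ := hW.δ_pos
  have hc := hW.c_pos
  have hθ : √c⁻¹ < 1 := by
    rw [Real.sqrt_lt' one_pos, one_pow]; exact inv_lt_one_of_one_lt₀ hW.one_lt_c
  set θ := √c⁻¹ with hθd
  have hθ0 : 0 ≤ θ := Real.sqrt_nonneg _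
  set V := √B with hV
  have hV0 : 0 ≤ V := Real.sqrt_nonneg _
  have h1 : 0 < 1 - θ := by linarith
  set C := V / δ / (1 - θ) with hC
  have hC0 : 0 ≤ C := by positivity
  have hCe : θ * C + V / δ = C := by rw [hC]; field_simp; ring
  refine ⟨C + 1, by linarith, fun N hN => ?_⟩
  have hrec : ∀ n, (walkExp S n fun f => totalExitWeight F S c δ N (F f)) ≤
      θ ^ n * (N * V) + C := by
    intro n
    induction n with
    | zero =>
      rw [walkExp, pow_zero, one_mul]
      refine le_trans ?_ (le_add_of_nonneg_right hC0)
      refine (Finset.sum_le_card_nsmul _ _ V fun j _ => Real.sqrt_le_sqrt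
        (hB _ _ (hW.lift.strictMono 1 (div_lt_succ_div hN j)))).trans ?_
      simp
    | succ n ih =>
      rw [walkExp_succ']
      refine (walkExp_mono' n fun f => hW.stepAvg_totalExitWeight_le hB hN f).trans ?_
      rw [walkExp_add, walkExp_mul_left, walkExp_const hW.nonempty]
      calc _ ≤ θ * (θ ^ n * (N * V) + C) + V / δ := by gcongr
        _ = θ ^ (n + 1) * (N * V) + (θ * C + V / δ) := by ring
        _ = _ := by rw [hCe]
  have hlim : Filter.Tendsto (fun n : ℕ => θ ^ n * (N * V)) Filter.atTop (nhds 0) := by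
    simpa using (tendsto_pow_atTop_nhds_zero_of_lt_one hθ0 hθ).mul_const (N * V)
  obtain ⟨n, hn⟩ := (hlim.eventually_le_const one_pos).exists
  exact ⟨n, (hrec n).trans (by linarith)⟩

theorem inv_L_le_deriv (hW : WalkConstants F S q c L δ)
    {s : G} (hs : s ∈ S) (x : ℝ) : L⁻¹ ≤ deriv (F s) x := by
  rw [eq_inv_of_mul_eq_one_right (hW.lift.deriv_inv_mul s x)]
  exact inv_anti₀ (hW.lift.deriv_pos _ _) (hW.deriv_le _ (hW.inv_mem s hs) _)

theorem walkExp_mono_of_deriv_bounds (hW : WalkConstants F S q c L δ) (n : ℕ) {Φ Ψ : G → ℝ}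
    (h : ∀ f, (∀ x, (L ^ n)⁻¹ ≤ deriv (F f) x ∧ deriv (F f) x ≤ L ^ n) → Φ f ≤ Ψ f) :
    walkExp S n Φ ≤ walkExp S n Ψ := by
  have hL := hW.L_pos
  refine walkExp_mono
    (P := fun n f => ∀ x, (L ^ n)⁻¹ ≤ deriv (F f) x ∧ deriv (F f) x ≤ L ^ n) (fun x => ?_)
    (fun n f hf s hs x => ?_) n h
  · simp [hW.lift.deriv_one]
  · obtain ⟨h1, h2⟩ := hf (F s x)
    have h3 := hW.inv_L_le_deriv hs x
    have h4 := hW.deriv_le s hs x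
    have := hW.lift.deriv_pos s x
    have := hW.lift.deriv_pos f (F s x)
    rw [hW.lift.deriv_mul, pow_succ, mul_inv]
    constructor <;> gcongr

theorem walkExp_deriv_arc_le (hW : WalkConstants F S q c L δ)
    {n m : ℕ} {a : ℝ} (ha : 0 < a) {x y : ℝ} (hxy : x < y) {f : G}
    (hf : ∀ x, (L ^ n)⁻¹ ≤ deriv (F f) x ∧ deriv (F f) x ≤ L ^ n)
    (hd : F f y - F f x ≤ δ) :
    (walkExp S m fun w => truthValue (∃ z ∈ Set.Icc x y,
      a * L ^ (2 * n) / (y - x) < deriv (F (w * f)) z)) ≤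
      (√a)⁻¹ * (c ^ 2 * q) ^ m + exitWeight F S c δ (F f x) (F f y) := by
  have hL := hW.L_pos
  have hc := hW.c_pos
  have hm := hW.lift.strictMono f
  have hl : 0 < y - x := by linarith
  have hlf : 0 < F f y - F f x := sub_pos.2 (hm hxy)
  refine (walkExp_mono' m fun w => truthValue_mono ?_).trans
    ((hW.walkExp_large_deriv_le m (t := a / c ^ (2 * m)) (by positivity) (hm hxy) hd).trans
    (add_le_add ?_ (hW.sum_exitProb_succ_le_exitWeight m (hm hxy))))
  · rintro ⟨z, hz, h⟩
    refine ⟨F f z, ⟨hm.monotone hz.1, hm.monotone hz.2⟩, ?_⟩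
    rw [hW.lift.deriv_mul, div_lt_iff₀ hl] at h
    rw [div_lt_iff₀ hlf, mul_div_cancel₀ _ (by positivity)]
    obtain ⟨w', -, e⟩ := hW.lift.exists_deriv_eq f hxy
    have hw0 := hW.lift.deriv_pos w (F f z)
    have h1 : (L ^ n)⁻¹ * (y - x) ≤ F f y - F f x := by
      rw [e]; exact mul_le_mul_of_nonneg_right (hf w').1 hl.le
    have h2 : deriv (F w) (F f z) * deriv (F f) z * (y - x) ≤
        deriv (F w) (F f z) * L ^ n * (y - x) := by
      gcongr; exact (hf z).2
    have h3 : L ^ (2 * n) * a < L ^ (2 * n) * (deriv (F w) (F f z) * ((L ^ n)⁻¹ * (y - x))) := by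
      calc _ < deriv (F w) (F f z) * L ^ n * (y - x) := by linarith
        _ = _ := by rw [pow_mul']; field_simp
    exact (lt_of_mul_lt_mul_left h3 (by positivity)).trans_le (by gcongr)
  · calc _ ≤ (√(a / c ^ (2 * m)))⁻¹ * (c * q) ^ m := by
          gcongr; exact hW.shortMass_le m (hm hxy)
      _ = _ := by
        rw [Real.sqrt_div ha.le, pow_mul', Real.sqrt_sq (by positivity)]
        field_simp; ring

/-- If the total exit weight of `f` is small, then a long random walk started at `f` contracts all
but boundedly many arcs with probability close to one. -/
theorem exists_walkExp_not_contractsOffArcs_le (hW : WalkConstants F S q c L δ)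
    {K : ℝ} (hK : 1 ≤ K) {N : ℕ} (hN : 0 < N) (n : ℕ)
    {t : ℝ} (ht : 0 < t) : ∃ m, ∀ f,
      (∀ x, (L ^ n)⁻¹ ≤ deriv (F f) x ∧ deriv (F f) x ≤ L ^ n) →
      totalExitWeight F S c δ N (F f) ≤ 8 * K →
      (walkExp S m fun w => truthValue (¬ContractsOffArcs (F (w * f)) ⌈512 * K ^ 2⌉₊ N t)) ≤
        1 / 4 := by
  classical
  have hL := hW.L_pos
  have hN' : (0 : ℝ) < N := by exact_mod_cast hN
  set a : ℝ := t / (L ^ (2 * n) * N) with ha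
  have ha0 : 0 < a := by positivity
  have hlim : Filter.Tendsto (fun m : ℕ => N * ((√a)⁻¹ * (c ^ 2 * q) ^ m)) Filter.atTop
      (nhds 0) := by
    simpa using ((tendsto_pow_atTop_nhds_zero_of_lt_one hW.c_sq_mul_q_nonneg
      hW.c_sq_mul_q).const_mul ((√a)⁻¹)).const_mul (N : ℝ)
  obtain ⟨m, hm⟩ := (hlim.eventually_le_const (by norm_num : (0 : ℝ) < 1 / 8)).exists
  refine ⟨m, fun f hf hZ => ?_⟩
  set v : ℕ → ℝ := fun j =>
    √(exitWeight F S c δ (F f ((j : ℝ) / N)) (F f ((j + 1 : ℝ) / N))) with hv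
  have hv0 : ∀ j, 0 ≤ v j := fun j => Real.sqrt_nonneg _
  have hlt : ∀ j : ℕ, F f ((j : ℝ) / N) < F f ((j + 1 : ℝ) / N) :=
    fun j => hW.lift.strictMono f (div_lt_succ_div hN j)
  have hvsq : ∀ j : ℕ, v j ^ 2 = exitWeight F S c δ (F f ((j : ℝ) / N)) (F f ((j + 1 : ℝ) / N)) :=
    fun j => Real.sq_sqrt (hW.exitWeight_nonneg _ _)
  set σ : ℝ := 1 / (64 * K) with hσ
  have hσ0 : 0 < σ := by positivity
  have hσ1 : σ < 1 := by rw [hσ, div_lt_one (by positivity)]; linarith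
  have hZ' : ∑ j ∈ Finset.range N, v j ≤ 8 * K := hZ
  set H := (Finset.range N).filter fun j => σ ≤ v j with hH
  set H' := (Finset.range N).filter fun j => ¬ σ ≤ v j with hH'
  have hcard : H.card ≤ ⌈512 * K ^ 2⌉₊ := by
    have h1 : H.card • σ ≤ ∑ j ∈ H, v j :=
      Finset.card_nsmul_le_sum _ _ _ fun j hj => (Finset.mem_filter.1 hj).2
    have h2 : ∑ j ∈ H, v j ≤ ∑ j ∈ Finset.range N, v j :=
      Finset.sum_le_sum_of_subset_of_nonneg (Finset.filter_subset _ _) fun j _ _ => hv0 j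
    have h3 : (H.card : ℝ) ≤ 512 * K ^ 2 := by
      rw [nsmul_eq_mul, hσ, mul_one_div] at h1
      have := (div_le_iff₀ (by positivity)).1 (h1.trans (h2.trans hZ'))
      linarith
    exact_mod_cast h3.trans (Nat.le_ceil _)
  have hsum : ∑ j ∈ H', v j ^ 2 ≤ 1 / 8 := by
    calc ∑ j ∈ H', v j ^ 2 ≤ ∑ j ∈ H', σ * v j := by
          refine Finset.sum_le_sum fun j hj => ?_
          rw [sq]
          exact mul_le_mul_of_nonneg_right (not_le.1 (Finset.mem_filter.1 hj).2).le (hv0 j)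
      _ ≤ ∑ j ∈ Finset.range N, σ * v j :=
          Finset.sum_le_sum_of_subset_of_nonneg (Finset.filter_subset _ _)
            fun j _ _ => mul_nonneg hσ0.le (hv0 j)
      _ = σ * ∑ j ∈ Finset.range N, v j := by rw [Finset.mul_sum]
      _ ≤ σ * (8 * K) := by gcongr
      _ = 1 / 8 := by rw [hσ]; field_simp; norm_num
  have hH'card : (H'.card : ℝ) ≤ N := by
    exact_mod_cast (Finset.card_filter_le _ _).trans (Finset.card_range N).le
  calc (walkExp S m fun w => truthValue (¬ContractsOffArcs (F (w * f)) ⌈512 * K ^ 2⌉₊ N t))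
      ≤ walkExp S m fun w => ∑ j ∈ H', truthValue (∃ z ∈ Set.Icc ((j : ℝ) / N) ((j + 1 : ℝ) / N),
          a * L ^ (2 * n) / ((j + 1 : ℝ) / N - (j : ℝ) / N) < deriv (F (w * f)) z) := by
        refine walkExp_mono' m fun w => truthValue_le
          (Finset.sum_nonneg fun _ _ => truthValue_nonneg _) fun h => ?_
        by_contra! hlt1
        refine h ⟨H, hcard, fun j hj hjH z hz => ?_⟩
        by_contra! hz1
        have hjH' : j ∈ H' := Finset.mem_filter.2 ⟨Finset.mem_range.2 hj, fun h' =>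
          hjH (Finset.mem_filter.2 ⟨Finset.mem_range.2 hj, h'⟩)⟩
        have h2 := Finset.single_le_sum (f := fun j : ℕ => truthValue
          (∃ z ∈ Set.Icc ((j : ℝ) / N) ((j + 1 : ℝ) / N),
          a * L ^ (2 * n) / ((j + 1 : ℝ) / N - (j : ℝ) / N) < deriv (F (w * f)) z))
          (fun _ _ => truthValue_nonneg _) hjH'
        have h3 : a * L ^ (2 * n) / ((j + 1 : ℝ) / N - (j : ℝ) / N) = t := by
          rw [ha]; field_simp; ring
        simp only [h3] at h2 hlt1
        rw [truthValue_of ⟨z, hz, hz1⟩] at h2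
        linarith
    _ = ∑ j ∈ H', walkExp S m fun w =>
          truthValue (∃ z ∈ Set.Icc ((j : ℝ) / N) ((j + 1 : ℝ) / N),
          a * L ^ (2 * n) / ((j + 1 : ℝ) / N - (j : ℝ) / N) < deriv (F (w * f)) z) :=
        walkExp_sum _ _ _
    _ ≤ ∑ j ∈ H', ((√a)⁻¹ * (c ^ 2 * q) ^ m + v j ^ 2) := by
        refine Finset.sum_le_sum fun j hj => ?_
        rw [hvsq]
        refine hW.walkExp_deriv_arc_le ha0 (div_lt_succ_div hN j) hf ?_
        by_contra! hd
        have h1 := hW.one_le_exitWeight (hlt j) hd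
        have h2 : v j < 1 := (not_le.1 (Finset.mem_filter.1 hj).2).trans hσ1
        have := hvsq j
        nlinarith [hv0 j]
    _ = H'.card * ((√a)⁻¹ * (c ^ 2 * q) ^ m) + ∑ j ∈ H', v j ^ 2 := by
        rw [Finset.sum_add_distrib, Finset.sum_const, nsmul_eq_mul]
    _ ≤ N * ((√a)⁻¹ * (c ^ 2 * q) ^ m) + 1 / 8 := by
        have := pow_nonneg hW.c_sq_mul_q_nonneg m
        gcongr
    _ ≤ 1 / 4 := by linarith

theorem exists_contractsOffArcs (hW : WalkConstants F S q c L δ)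
    : ∃ M : ℕ, ∀ N : ℕ, 0 < N → ∀ t : ℝ, 0 < t →
    ∃ f : G, ContractsOffArcs (F f) M N t ∧ ContractsOffArcs (F f⁻¹) M N t := by
  obtain ⟨K, hK, h⟩ := hW.exists_walkExp_totalExitWeight_le
  refine ⟨⌈512 * K ^ 2⌉₊, fun N hN t ht => ?_⟩
  obtain ⟨n, hn⟩ := h N hN
  obtain ⟨m, hm⟩ := hW.exists_walkExp_not_contractsOffArcs_le hK hN n ht
  set bad : G → ℝ := fun f => truthValue (¬ContractsOffArcs (F f) ⌈512 * K ^ 2⌉₊ N t) with hbad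
  have hle : walkExp S (n + m) bad ≤ 3 / 8 := by
    rw [walkExp_time_add]
    refine (hW.walkExp_mono_of_deriv_bounds n (Ψ := fun f =>
      (8 * K)⁻¹ * totalExitWeight F S c δ N (F f) + 1 / 4) fun f hf => ?_).trans ?_
    · have h0 := totalExitWeight_nonneg F S c δ N (F f)
      by_cases hZ : totalExitWeight F S c δ N (F f) ≤ 8 * K
      · refine (hm f hf hZ).trans (le_add_of_nonneg_left (by positivity))
      · refine (walkExp_mono' m fun w => truthValue_le_one _).trans ?_
        rw [walkExp_const hW.nonempty]
        have : 1 ≤ (8 * K)⁻¹ * totalExitWeight F S c δ N (F f) := by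
          rw [inv_mul_eq_div, one_le_div (by positivity)]
          exact (not_le.1 hZ).le
        linarith
    · rw [walkExp_add, walkExp_mul_left, walkExp_const hW.nonempty]
      calc _ ≤ (8 * K)⁻¹ * K + 1 / 4 := by gcongr
        _ = 3 / 8 := by field_simp; norm_num
  by_contra! hcon
  have h1 : walkExp S (n + m) (fun _ => (1 : ℝ)) ≤
      walkExp S (n + m) fun f => bad f + bad f⁻¹ := by
    refine walkExp_mono' _ fun f => ?_
    by_cases hf : ContractsOffArcs (F f) ⌈512 * K ^ 2⌉₊ N t
    · rw [hbad]; simp only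
      rw [truthValue_of (hcon f hf)]
      linarith [truthValue_nonneg (¬ContractsOffArcs (F f) ⌈512 * K ^ 2⌉₊ N t)]
    · rw [hbad]; simp only
      rw [truthValue_of hf]
      linarith [truthValue_nonneg (¬ContractsOffArcs (F f⁻¹) ⌈512 * K ^ 2⌉₊ N t)]
  rw [walkExp_add, walkExp_inv hW.inv_mem, walkExp_const hW.nonempty] at h1
  linarith

end WalkConstants
end Clustering

section FixedPoints

theorem unitAddCircle_coe_eq_coe_iff {a b : ℝ} :
    (a : UnitAddCircle) = b ↔ ∃ n : ℤ, a = b + n := by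
  rw [← sub_eq_zero, ← AddCircle.coe_sub, AddCircle.coe_eq_zero_iff]
  exact exists_congr fun n => by
    rw [zsmul_one, eq_sub_iff_add_eq, add_comm, eq_comm]

theorem dist_coe_unitAddCircle_le (a b : ℝ) : dist (a : UnitAddCircle) b ≤ |a - b| := by
  rw [dist_eq_norm, ← AddCircle.coe_sub, UnitAddCircle.norm_eq]
  simpa using round_le (a - b) 0

theorem exists_abs_sub_int_eq_dist (a b : ℝ) :
    ∃ n : ℤ, |a - n - b| = dist (a : UnitAddCircle) b := by
  refine ⟨round (a - b), ?_⟩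
  rw [dist_eq_norm, ← AddCircle.coe_sub, UnitAddCircle.norm_eq]
  congr 1; ring

theorem finite_fixedPoints_of_deriv_ne_one {f : UnitAddCircle ≃ₜ UnitAddCircle} {F : ℝ → ℝ}
    (hF : IsOPC1Lift f F)
    (h : ∀ x : ℝ, f (x : UnitAddCircle) = (x : UnitAddCircle) → deriv F x ≠ 1) :
    {p : UnitAddCircle | f p = p}.Finite := by
  have hd : Differentiable ℝ F := hF.1.differentiable one_ne_zero
  have hfix : ∀ x : ℝ, f (x : UnitAddCircle) = x ↔ ∃ n : ℤ, F x - x = n := fun x => by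
    rw [hF.2.2.2, unitAddCircle_coe_eq_coe_iff]
    exact exists_congr fun n => by rw [sub_eq_iff_eq_add']
  have hfin : {x ∈ Set.Icc (0 : ℝ) 1 | f (x : UnitAddCircle) = x}.Finite := by
    by_contra hinf
    obtain ⟨x, -, hx⟩ := Set.Infinite.exists_accPt_of_subset_isCompact hinf isCompact_Icc
      (Set.sep_subset _ _)
    rw [accPt_iff_frequently_nhdsNE] at hx
    have hcl : IsClosed {x : ℝ | f (x : UnitAddCircle) = x} :=
      isClosed_eq (f.continuous.comp (AddCircle.continuous_mk' 1)) (AddCircle.continuous_mk' 1)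
    have hxf : f (x : UnitAddCircle) = x := by
      have : x ∈ closure {x : ℝ | f (x : UnitAddCircle) = x} :=
        mem_closure_iff_frequently.2 ((hx.mono fun y hy => hy.2).filter_mono nhdsWithin_le_nhds)
      rwa [hcl.closure_eq] at this
    obtain ⟨n, hn⟩ := (hfix x).1 hxf
    have hder : HasDerivAt (fun y => F y - y) (deriv F x - 1) x :=
      (hd x).hasDerivAt.sub (hasDerivAt_id x)
    have h1 := hder.eventually_ne (c := (n : ℝ)) (sub_ne_zero.2 (h x hxf))
    have h2 : ∀ᶠ y in nhdsWithin x {x}ᶜ, |F y - y - n| < 1 := by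
      have hc : Continuous fun y => |F y - y - n| :=
        ((hd.continuous.sub continuous_id).sub continuous_const).abs
      refine nhdsWithin_le_nhds (hc.continuousAt.eventually_lt continuousAt_const ?_)
      simp [hn]
    obtain ⟨y, hy, hy1, hy2⟩ := (hx.and_eventually (h1.and h2)).exists
    obtain ⟨m, hm⟩ := (hfix y).1 hy.2
    rw [hm] at hy1 hy2
    refine hy1 ?_
    have : |m - n| < 1 := by exact_mod_cast hy2
    rw [Int.abs_lt_one_iff, sub_eq_zero] at this
    rw [this]
  refine (hfin.image ((↑) : ℝ → UnitAddCircle)).subset fun p hp => ?_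
  obtain ⟨x, hx, rfl⟩ : p ∈ QuotientAddGroup.mk '' Set.Icc (0 : ℝ) (0 + 1) := by
    rw [AddCircle.coe_image_Icc_eq 1 0]; trivial
  rw [zero_add] at hx
  exact ⟨x, ⟨hx, hp⟩, rfl⟩

variable {G : Type*} [Group G] {F : G → ℝ → ℝ} {ρ : G →* (UnitAddCircle ≃ₜ UnitAddCircle)}

theorem map_mul_apply (g h : G) (p : UnitAddCircle) : ρ (g * h) p = ρ g (ρ h p) := by
  rw [map_mul]; rfl

theorem map_one_apply (p : UnitAddCircle) : ρ 1 p = p := by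
  rw [map_one]; rfl

theorem map_inv_apply_self (g : G) (p : UnitAddCircle) : ρ g⁻¹ (ρ g p) = p := by
  rw [← map_mul_apply, inv_mul_cancel, map_one_apply]

theorem map_apply_inv_self (g : G) (p : UnitAddCircle) : ρ g (ρ g⁻¹ p) = p := by
  rw [← map_mul_apply, mul_inv_cancel, map_one_apply]

/-- Derivatives of powers on a forward-invariant set where `g` contracts. -/
theorem deriv_pow_le (hF : ∀ g : G, IsOPC1Lift (ρ g) (F g)) {g : G} {W : Set UnitAddCircle}
    (hW : ∀ p ∈ W, ρ g p ∈ W) {a : ℝ} (ha : ∀ x : ℝ, (x : UnitAddCircle) ∈ W → deriv (F g) x ≤ a)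
    (k : ℕ) {x : ℝ} (hx : (x : UnitAddCircle) ∈ W) : deriv (F (g ^ k)) x ≤ a ^ k := by
  have hL := isLiftSystem_of_isOPC1Lift hF
  induction k generalizing x with
  | zero => simp [hL.deriv_one]
  | succ k ih =>
    rw [pow_succ, pow_succ, hL.deriv_mul]
    have h1 : ((F g x : ℝ) : UnitAddCircle) ∈ W := by
      rw [← (hF g).2.2.2]; exact hW _ hx
    exact mul_le_mul (ih h1) (ha x hx) (hL.deriv_pos _ _).le ((hL.deriv_pos _ _).le.trans (ih h1))

theorem exists_hyperbolic_of_ping_pong (hF : ∀ g : G, IsOPC1Lift (ρ g) (F g)) {g : G}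
    {U V : Set UnitAddCircle} {η : ℝ} (hη : 0 < η) (hV : V.Nonempty)
    (hUV : ∀ p ∈ U, ∀ r ∈ V, η < dist p r)
    (hU1 : ∀ x : ℝ, (x : UnitAddCircle) ∉ U → deriv (F g) x ≤ 1 / 2)
    (hV1 : ∀ x : ℝ, (x : UnitAddCircle) ∉ V → deriv (F g⁻¹) x ≤ 1 / 2) :
    ∃ h : G, ({p : UnitAddCircle | ρ h p = p}.Nonempty ∧ {p : UnitAddCircle | ρ h p = p}.Finite) ∧
      ∀ x : ℝ, ρ h (x : UnitAddCircle) = (x : UnitAddCircle) → deriv (F h) x ≠ 1 := by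
  have hL := isLiftSystem_of_isOPC1Lift hF
  have hdisj : ∀ p ∈ V, p ∉ U := fun p hp hp' => by
    have := hUV p hp' p hp
    rw [dist_self] at this
    linarith
  have hUtoV : ∀ p, p ∉ U → ρ g p ∈ V := by
    intro p hp
    obtain ⟨x, rfl⟩ := QuotientAddGroup.mk_surjective p
    by_contra hcon
    have h1 := hU1 x hp
    have h2 := hV1 (F g x) (by rw [← (hF g).2.2.2]; exact hcon)
    have h3 := hL.deriv_inv_mul g x
    have h4 := hL.deriv_pos g x
    have h5 := hL.deriv_pos g⁻¹ (F g x)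
    nlinarith
  have hinvU : ∀ p ∈ Uᶜ, ρ g p ∈ Uᶜ := fun p hp => hdisj _ (hUtoV p hp)
  have hinvV : ∀ p ∈ Vᶜ, ρ g⁻¹ p ∈ Vᶜ := fun p hp hp' => by
    have := hUtoV _ (hdisj _ hp')
    rw [map_apply_inv_self] at this
    exact hp this
  obtain ⟨x0, hx0⟩ := hV
  have horb : ∀ k : ℕ, ρ (g ^ k) x0 ∈ V := by
    intro k
    induction k with
    | zero => rwa [pow_zero, map_one_apply]
    | succ k ih => rw [pow_succ', map_mul_apply]; exact hUtoV _ (hdisj _ ih)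
  obtain ⟨i, p, hp, hclose⟩ : ∃ i p : ℕ, 0 < p ∧
      dist (ρ (g ^ p) (ρ (g ^ i) x0)) (ρ (g ^ i) x0) < η / 2 := by
    obtain ⟨l, -, φ, hφ, hl⟩ := isCompact_univ.tendsto_subseq
      (x := fun k : ℕ => ρ (g ^ k) x0) fun _ => Set.mem_univ _
    obtain ⟨N, hN⟩ := Metric.cauchySeq_iff'.1 hl.cauchySeq (η / 2) (by positivity)
    refine ⟨φ N, φ (N + 1) - φ N, Nat.sub_pos_of_lt (hφ N.lt_succ_self), ?_⟩
    rw [← map_mul_apply, ← pow_add, Nat.sub_add_cancel (hφ N.lt_succ_self).le]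
    exact hN (N + 1) N.le_succ
  have hpow : (1 / 2 : ℝ) ^ p ≤ 1 / 2 := pow_le_of_le_one (by norm_num) (by norm_num) hp.ne'
  have hder : ∀ x : ℝ, (x : UnitAddCircle) ∉ U → deriv (F (g ^ p)) x ≤ 1 / 2 := fun x hx =>
    (deriv_pow_le hF (W := Uᶜ) hinvU hU1 p hx).trans hpow
  have hhyp : ∀ x : ℝ, ρ (g ^ p) (x : UnitAddCircle) = (x : UnitAddCircle) →
      deriv (F (g ^ p)) x ≠ 1 := by
    intro x hx h1
    by_cases hxU : (x : UnitAddCircle) ∈ U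
    · have hxV : (x : UnitAddCircle) ∈ Vᶜ := fun h => hdisj _ h hxU
      have h2 := (deriv_pow_le hF (W := Vᶜ) hinvV hV1 p hxV).trans hpow
      have h3 := hL.deriv_inv_mul (g ^ p) x
      rw [(hF _).2.2.2, unitAddCircle_coe_eq_coe_iff] at hx
      obtain ⟨n, hn⟩ := hx
      rw [h1, mul_one, hn, hL.deriv_add_int, ← inv_pow] at h3
      linarith
    · linarith [hder x hxU]
  refine ⟨g ^ p, ⟨?_, finite_fixedPoints_of_deriv_ne_one (hF _) hhyp⟩, hhyp⟩
  obtain ⟨y, hy⟩ := QuotientAddGroup.mk_surjective (ρ (g ^ i) x0)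
  have hyV : (y : UnitAddCircle) ∈ V := by
    have := horb i
    rw [← hy] at this
    exact this
  have hyc : dist (ρ (g ^ p) (y : UnitAddCircle)) y < η / 2 := by
    rw [← hy] at hclose
    exact hclose
  rw [(hF _).2.2.2] at hyc
  obtain ⟨n, hn⟩ := exists_abs_sub_int_eq_dist (F (g ^ p) y) y
  rw [← hn, abs_lt] at hyc
  have hoff : ∀ z : ℝ, |z - y| ≤ η → (z : UnitAddCircle) ∉ U := fun z hz hzU => by
    have h1 := hUV _ hzU _ hyV
    have h2 := dist_coe_unitAddCircle_le z y
    linarith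
  obtain ⟨z1, hz1, e1⟩ := hL.exists_deriv_eq (g ^ p) (by linarith : y < y + η)
  obtain ⟨z2, hz2, e2⟩ := hL.exists_deriv_eq (g ^ p) (by linarith : y - η < y)
  have d1 := hder z1 (hoff z1 (by rw [abs_le]; constructor <;> linarith [hz1.1, hz1.2]))
  have d2 := hder z2 (hoff z2 (by rw [abs_le]; constructor <;> linarith [hz2.1, hz2.2]))
  have hc : Continuous fun z => F (g ^ p) z - z := (hL.continuous _).sub continuous_id
  have hmem : (n : ℝ) ∈ Set.Icc (F (g ^ p) (y + η) - (y + η)) (F (g ^ p) (y - η) - (y - η)) := by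
    constructor <;> nlinarith
  obtain ⟨z, -, hz⟩ := intermediate_value_Icc' (by linarith : y - η ≤ y + η) hc.continuousOn hmem
  refine ⟨(z : UnitAddCircle), ?_⟩
  rw [Set.mem_ofPred_eq, (hF _).2.2.2, unitAddCircle_coe_eq_coe_iff]
  exact ⟨n, by simp only at hz; linarith⟩

end FixedPoints

section Separation

variable {G : Type*} [Group G] {F : G → ℝ → ℝ} {ρ : G →* (UnitAddCircle ≃ₜ UnitAddCircle)}

/-- A map contracting off `M` arcs of length `1/N` contracts off `M + 1` balls of radius `1/N`. -/
theorem ContractsOffArcs.exists_centers {f : ℝ → ℝ} {M N : ℕ} {t : ℝ}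
    (h : ContractsOffArcs f M N t) (hN : 0 < N)
    (hper : ∀ (x : ℝ) (n : ℤ), deriv f (x + n) = deriv f x) :
    ∃ R : Fin (M + 1) → UnitAddCircle, ∀ x : ℝ,
      (∀ i, 1 / (N : ℝ) < dist (x : UnitAddCircle) (R i)) → deriv f x ≤ t := by
  obtain ⟨H, hH, hd⟩ := h
  have hN' : (0 : ℝ) < N := Nat.cast_pos.2 hN
  refine ⟨fun i => ((((H.toList.getD i 0 : ℕ) : ℝ) / N : ℝ) : UnitAddCircle), fun x hx => ?_⟩
  set j := ⌊N * Int.fract x⌋₊ with hj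
  have h0 : 0 ≤ N * Int.fract x := mul_nonneg hN'.le (Int.fract_nonneg x)
  have h1 : (j : ℝ) ≤ N * Int.fract x := Nat.floor_le h0
  have h2 : N * Int.fract x < j + 1 := Nat.lt_floor_add_one _
  have h3 : (j : ℝ) / N ≤ Int.fract x := by rw [div_le_iff₀ hN']; linarith
  have h4 : Int.fract x ≤ (j + 1 : ℝ) / N := by rw [le_div_iff₀ hN']; linarith
  have hjN : j < N := by
    have : (j : ℝ) < N := by nlinarith [Int.fract_lt_one x]
    exact_mod_cast this
  have hfr : x = Int.fract x + ⌊x⌋ := (Int.fract_add_floor x).symm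
  rw [hfr, hper]
  refine hd j hjN (fun hjH => ?_) _ ⟨h3, h4⟩
  obtain ⟨i, hi, hij⟩ := List.getElem_of_mem (Finset.mem_toList.2 hjH)
  have hx' := hx ⟨i, by rw [Finset.length_toList] at hi; omega⟩
  simp only [List.getD_eq_getElem _ _ hi, hij] at hx'
  have hxf : (x : UnitAddCircle) = (Int.fract x : ℝ) :=
    unitAddCircle_coe_eq_coe_iff.2 ⟨⌊x⌋, hfr⟩
  rw [hxf] at hx'
  have := hx'.trans_le (dist_coe_unitAddCircle_le _ _)
  rw [abs_of_nonneg (by linarith)] at this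
  have h5 : (j + 1 : ℝ) / N = j / N + 1 / N := add_div _ _ _
  linarith

/-- There are finitely many repelling and attracting points for a sequence of group elements
whose derivatives go to zero away from them. -/
theorem WalkConstants.exists_limit_points {S : Finset G} {q c L δ : ℝ}
    (hL : IsLiftSystem F) (hW : WalkConstants F S q c L δ) :
    ∃ (n : ℕ) (R A : Fin (n + 1) → UnitAddCircle), ∀ ε : ℝ, 0 < ε → ∃ f : G,
      (∀ x : ℝ, (∀ i, ε ≤ dist (x : UnitAddCircle) (R i)) → deriv (F f) x ≤ ε) ∧
      ∀ x : ℝ, (∀ i, ε ≤ dist (x : UnitAddCircle) (A i)) → deriv (F f⁻¹) x ≤ ε := by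
  obtain ⟨M, hM⟩ := hW.exists_contractsOffArcs
  have key : ∀ k : ℕ, ∃ (f : G) (P : (Fin (M + 1) → UnitAddCircle) × (Fin (M + 1) → UnitAddCircle)),
      (∀ x : ℝ, (∀ i, 1 / ((k : ℝ) + 1) < dist (x : UnitAddCircle) (P.1 i)) →
        deriv (F f) x ≤ 1 / ((k : ℝ) + 1)) ∧
      ∀ x : ℝ, (∀ i, 1 / ((k : ℝ) + 1) < dist (x : UnitAddCircle) (P.2 i)) →
        deriv (F f⁻¹) x ≤ 1 / ((k : ℝ) + 1) := by
    intro k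
    obtain ⟨f, h1, h2⟩ := hM (k + 1) k.succ_pos (1 / ((k : ℝ) + 1)) Nat.one_div_pos_of_nat
    obtain ⟨R, hR⟩ := h1.exists_centers k.succ_pos (hL.deriv_add_int f)
    obtain ⟨A, hA⟩ := h2.exists_centers k.succ_pos (hL.deriv_add_int f⁻¹)
    rw [Nat.cast_succ] at hR hA
    exact ⟨f, (R, A), hR, hA⟩
  choose f P hR hA using key
  obtain ⟨⟨R, A⟩, -, φ, hφ, hl⟩ := isCompact_univ.tendsto_subseq (x := P) fun _ => Set.mem_univ _
  refine ⟨M, R, A, fun ε hε => ?_⟩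
  have e1 : ∀ᶠ k in Filter.atTop, dist (P (φ k)) (R, A) < ε / 2 :=
    Metric.tendsto_nhds.1 hl _ (half_pos hε)
  have e2 : ∀ᶠ k in Filter.atTop, 1 / ((φ k : ℝ) + 1) < ε / 2 :=
    (tendsto_one_div_add_atTop_nhds_zero_nat.comp hφ.tendsto_atTop).eventually_lt_const
      (half_pos hε)
  obtain ⟨k, h1, h2⟩ := (e1.and e2).exists
  rw [Prod.dist_eq, max_lt_iff] at h1
  refine ⟨f (φ k), fun x hx => (hR _ x fun i => ?_).trans (by linarith),
    fun x hx => (hA _ x fun i => ?_).trans (by linarith)⟩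
  · have := dist_triangle (x : UnitAddCircle) ((P (φ k)).1 i) (R i)
    have := (dist_le_pi_dist (P (φ k)).1 R i).trans_lt h1.1
    linarith [hx i]
  · have := dist_triangle (x : UnitAddCircle) ((P (φ k)).2 i) (A i)
    have := (dist_le_pi_dist (P (φ k)).2 A i).trans_lt h1.2
    linarith [hx i]

theorem infinite_orbit_of_not_exists_invariant
    (hno : ¬ ∃ μ : Measure UnitAddCircle, IsProbabilityMeasure μ ∧
      ∀ g : G, Measure.map (ρ g) μ = μ) (p : UnitAddCircle) :
    (Set.range fun g => ρ g p).Infinite := by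
  intro hfin
  have hmem : ∀ {r}, r ∈ hfin.toFinset ↔ ∃ g, ρ g p = r := by
    intro r; rw [Set.Finite.mem_toFinset, Set.mem_range]
  have hstab : ∀ g : G, ∀ r ∈ hfin.toFinset, ρ g r ∈ hfin.toFinset := by
    intro g r hr
    obtain ⟨k, rfl⟩ := hmem.1 hr
    exact hmem.2 ⟨g * k, map_mul_apply _ _ _⟩
  have hcard : (hfin.toFinset.card : ENNReal) ≠ 0 := by
    rw [Nat.cast_ne_zero, Finset.card_ne_zero]
    exact ⟨p, hmem.2 ⟨1, map_one_apply p⟩⟩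
  refine hno ⟨(hfin.toFinset.card : ENNReal)⁻¹ • ∑ r ∈ hfin.toFinset, Measure.dirac r, ⟨?_⟩,
    fun g => ?_⟩
  · simp only [Measure.smul_apply, Measure.finsetSum_apply, measure_univ, Finset.sum_const,
      nsmul_eq_mul, mul_one, smul_eq_mul]
    exact ENNReal.inv_mul_cancel hcard (ENNReal.natCast_ne_top _)
  · have hm : Measurable (ρ g) := (ρ g).continuous.measurable
    rw [Measure.map_smul, Measure.map_finset_sum hm.aemeasurable]
    congr 1
    refine Finset.sum_nbij' (ρ g) (ρ g⁻¹) (hstab g) (hstab g⁻¹)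
      (fun r _ => map_inv_apply_self g r) (fun r _ => map_apply_inv_self g r) fun r _ => ?_
    rw [Measure.map_dirac' hm]

open scoped Pointwise in
/-- If all orbits are infinite, finitely many points can be moved off finitely many points. -/
theorem exists_forall_apply_ne_of_infinite_orbit
    (h : ∀ p, (Set.range fun g => ρ g p).Infinite) {ι κ : Type*} [Finite ι] [Finite κ]
    (A : ι → UnitAddCircle) (R : κ → UnitAddCircle) :
    ∃ g : G, ∀ i j, ρ g (A i) ≠ R j := by
  classical
  cases nonempty_fintype ι
  cases nonempty_fintype κ
  by_contra! hcon
  let H : ι × κ → Subgroup G := fun i =>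
    { carrier := {g | ρ g (A i.1) = A i.1}
      one_mem' := map_one_apply _
      mul_mem' := fun {a b} ha hb => by
        change ρ (a * b) _ = _
        rw [map_mul_apply, show ρ b _ = _ from hb, show ρ a _ = _ from ha]
      inv_mem' := fun {a} ha => by
        change ρ a⁻¹ _ = _
        nth_rewrite 1 [← show ρ a _ = _ from ha]
        exact map_inv_apply_self _ _ }
  have hH : ∀ i g, g ∈ H i ↔ ρ g (A i.1) = A i.1 := fun i g => Iff.rfl
  let u : ι × κ → G := fun i =>
    if hi : ∃ g, ρ g (A i.1) = R i.2 then hi.choose else 1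
  have hcov : ⋃ i ∈ (Finset.univ : Finset (ι × κ)), u i • (H i : Set G) = Set.univ := by
    refine Set.eq_univ_of_forall fun g => ?_
    obtain ⟨i, j, hij⟩ := hcon g
    refine Set.mem_biUnion (Finset.mem_coe.2 (Finset.mem_univ (i, j))) ?_
    have hex : ∃ g, ρ g (A i) = R j := ⟨g, hij⟩
    have hu : ρ (u (i, j)) (A i) = R j := by
      simp only [u, dif_pos hex]
      exact hex.choose_spec
    rw [Set.mem_smul_set_iff_inv_smul_mem, smul_eq_mul, SetLike.mem_coe, hH, map_mul_apply, hij,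
      ← hu, map_inv_apply_self]
  obtain ⟨i, -, hi⟩ := Subgroup.exists_finiteIndex_of_leftCoset_cover hcov
  refine h (A i.1) ((Set.finite_range fun r : G ⧸ H i => ρ r.out (A i.1)).subset ?_)
  rintro _ ⟨g, rfl⟩
  refine ⟨(g : G ⧸ H i), ?_⟩
  obtain ⟨k, hk⟩ := QuotientGroup.mk_out_eq_mul (H i) g
  simp only
  rw [hk, map_mul_apply, (hH i k).1 k.2]

theorem exists_hyperbolic_of_limit_points (hF : ∀ g : G, IsOPC1Lift (ρ g) (F g)) {n : ℕ}
    {R A : Fin (n + 1) → UnitAddCircle}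
    (hRA : ∀ ε : ℝ, 0 < ε → ∃ f : G,
      (∀ x : ℝ, (∀ i, ε ≤ dist (x : UnitAddCircle) (R i)) → deriv (F f) x ≤ ε) ∧
      ∀ x : ℝ, (∀ i, ε ≤ dist (x : UnitAddCircle) (A i)) → deriv (F f⁻¹) x ≤ ε)
    {h : G} (hh : ∀ i j, ρ h (A i) ≠ R j) :
    ∃ g : G, ({p : UnitAddCircle | ρ g p = p}.Nonempty ∧ {p : UnitAddCircle | ρ g p = p}.Finite) ∧
      ∀ x : ℝ, ρ g (x : UnitAddCircle) = (x : UnitAddCircle) → deriv (F g) x ≠ 1 := by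
  have hL := isLiftSystem_of_isOPC1Lift hF
  obtain ⟨η, hη, hsep⟩ : ∃ η > 0, ∀ i j, 3 * η ≤ dist (R j) (ρ h (A i)) := by
    obtain ⟨k, hk⟩ := Finite.exists_min fun k : Fin (n + 1) × Fin (n + 1) =>
      dist (R k.2) (ρ h (A k.1))
    have : 0 < dist (R k.2) (ρ h (A k.1)) := dist_pos.2 (hh _ _).symm
    exact ⟨dist (R k.2) (ρ h (A k.1)) / 3, by positivity, fun i j => by linarith [hk (i, j)]⟩
  obtain ⟨C, hC⟩ := hL.exists_deriv_le h
  obtain ⟨C', hC'⟩ := hL.exists_deriv_le h⁻¹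
  have hC0 : 0 < C := (hL.deriv_pos h 0).trans_le (hC 0)
  have hC0' : 0 < C' := (hL.deriv_pos h⁻¹ 0).trans_le (hC' 0)
  obtain ⟨κ, hκ, huc⟩ := Metric.uniformContinuous_iff.1
    (CompactSpace.uniformContinuous_of_continuous (ρ h).continuous) η hη
  obtain ⟨ε, hε, h1, h2, h3, h4⟩ : ∃ ε > 0, ε ≤ η ∧ ε ≤ κ ∧ C * ε ≤ 1 / 2 ∧ ε * C' ≤ 1 / 2 := by
    refine ⟨min (min η κ) (min (1 / (2 * C)) (1 / (2 * C'))), by positivity, ?_, ?_, ?_, ?_⟩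
    · exact (min_le_left _ _).trans (min_le_left _ _)
    · exact (min_le_left _ _).trans (min_le_right _ _)
    · refine (mul_le_mul_of_nonneg_left ((min_le_right _ _).trans (min_le_left _ _))
        hC0.le).trans_eq ?_
      field_simp
    · refine (mul_le_mul_of_nonneg_right ((min_le_right _ _).trans (min_le_right _ _))
        hC0'.le).trans_eq ?_
      field_simp
  obtain ⟨f, hf1, hf2⟩ := hRA ε hε
  refine exists_hyperbolic_of_ping_pong hF (g := h * f) (U := {p | ∃ i, dist p (R i) < η})
    (V := {p | ∃ i, dist p (ρ h (A i)) < η}) (half_pos hη)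
    ⟨ρ h (A 0), 0, by rwa [dist_self]⟩ ?_ ?_ ?_
  · rintro p ⟨j, hj⟩ r ⟨i, hi⟩
    have e1 := hsep i j
    have e2 := dist_triangle4 (R j) p r (ρ h (A i))
    rw [dist_comm (R j) p] at e2
    linarith
  · intro x hx
    have hx' : ∀ i, η ≤ dist (x : UnitAddCircle) (R i) := fun i => by
      by_contra! hlt
      exact hx ⟨i, hlt⟩
    rw [hL.deriv_mul]
    exact (mul_le_mul (hC _) (hf1 x fun i => h1.trans (hx' i)) (hL.deriv_pos _ _).le
      hC0.le).trans h3
  · intro x hx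
    rw [mul_inv_rev, hL.deriv_mul]
    refine (mul_le_mul (hf2 _ fun i => ?_) (hC' x) (hL.deriv_pos _ _).le hε.le).trans h4
    by_contra! hlt
    refine hx ⟨i, ?_⟩
    have := huc (hlt.trans_le h2)
    rwa [← (hF h⁻¹).2.2.2, map_apply_inv_self] at this

end Separation

/-- **Theorem (Deroin–Kleptsyn–Navas).** Let `G` be a countable group with an
orientation-preserving `C¹` action on the circle, with a chosen lift `F g` for
each `g`. If there is no invariant Borel probability measure, then some `g ∈ G`
has a nonempty finite fixed-point set all of whose fixed points are hyperbolic
(the derivative of the lift at any point over a fixed point is `≠ 1`). -/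
theorem deroin_kleptsyn_navas_hyperbolic_element
    {G : Type*} [Group G] [Countable G]
    (ρ : G →* (UnitAddCircle ≃ₜ UnitAddCircle))
    (F : G → ℝ → ℝ)
    (hF : ∀ g : G, IsOPC1Lift (ρ g) (F g))
    (hno : ¬ ∃ μ : Measure UnitAddCircle, IsProbabilityMeasure μ ∧
      ∀ g : G, Measure.map (ρ g) μ = μ) :
    ∃ g : G,
      ({p : UnitAddCircle | ρ g p = p}.Nonempty ∧ {p : UnitAddCircle | ρ g p = p}.Finite) ∧
      ∀ x : ℝ, ρ g (x : UnitAddCircle) = (x : UnitAddCircle) → deriv (F g) x ≠ 1 := by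
  obtain ⟨S, q, c, L, δ, hW⟩ := exists_walkConstants ρ hF hno
  obtain ⟨n, R, A, hRA⟩ := hW.exists_limit_points (isLiftSystem_of_isOPC1Lift hF)
  obtain ⟨h, hh⟩ := exists_forall_apply_ne_of_infinite_orbit
    (infinite_orbit_of_not_exists_invariant hno) A R
  exact exists_hyperbolic_of_limit_points hF hRA hh
end

section
/- Let G be a finitely generated group with trivial abelianization (H₁(G,ℤ) = 0), and let ρ be a C¹ action of G on the circle that preserves some Borel probability measure μ on S¹ (the pushforward of μ under ρ(g) equals μ for all g ∈ G). Then the action is trivial: ρ(g) is the identity homeomorphism of the circle for every g ∈ G. -/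
open MeasureTheory

open Filter Topology Asymptotics

/-- A homomorphism from a perfect group to an abelian group is trivial. -/
theorem MonoidHom.apply_eq_one_of_subsingleton_abelianization {G A : Type*} [Group G]
    [CommGroup A] (hab : Subsingleton (Abelianization G)) (f : G →* A) (g : G) : f g = 1 := by
  rw [← Abelianization.lift_apply_of f g, Subsingleton.elim (Abelianization.of g) 1, map_one]

section Thurston

variable {G : Type*} [Group G] [MulAction G ℝ]

/-- A perfect group acting on the line by `C¹` maps has derivative one at its fixed points. -/
theorem deriv_smul_eq_one_of_mem_fixedPoints (hab : Subsingleton (Abelianization G))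
    (hC : ∀ g : G, ContDiff ℝ 1 fun x : ℝ => g • x) {p : ℝ}
    (hp : p ∈ MulAction.fixedPoints G ℝ) (g : G) : deriv (fun x : ℝ => g • x) p = 1 := by
  have hd : ∀ g : G, DifferentiableAt ℝ (fun x : ℝ => g • x) p := fun g =>
    ((hC g).differentiable one_ne_zero).differentiableAt
  let D : G →* ℝ :=
    { toFun := fun g => deriv (fun x : ℝ => g • x) p
      map_one' := by simp
      map_mul' := fun g h => by
        have hh := (hd h).hasDerivAt
        have hg : HasDerivAt (fun x : ℝ => g • x) (deriv (fun x : ℝ => g • x) p) (h • p) := by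
          rw [hp h]; exact (hd g).hasDerivAt
        have := (hg.comp p hh).deriv
        simpa only [Function.comp_def, mul_smul] using this }
  have h := MonoidHom.apply_eq_one_of_subsingleton_abelianization hab D.toHomUnits g
  simpa [D] using congrArg Units.val h

/-- Displacements of a perfect group acting by `C¹` maps are additive up to a small error near a
common fixed point. -/
theorem isLittleO_displacement_mul (hab : Subsingleton (Abelianization G))
    (hC : ∀ g : G, ContDiff ℝ 1 fun x : ℝ => g • x) {p : ℝ}
    (hp : p ∈ MulAction.fixedPoints G ℝ) (g h : G) :
    (fun x : ℝ => ((g * h) • x - x) - (g • x - x) - (h • x - x)) =o[𝓝 p]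
      fun x : ℝ => h • x - x := by
  have hs := ((hC g).hasStrictDerivAt (x := p) one_ne_zero).hasStrictFDerivAt.isLittleO
  rw [deriv_smul_eq_one_of_mem_fixedPoints hab hC hp g] at hs
  have ht : Tendsto (fun x : ℝ => (h • x, x)) (𝓝 p) (𝓝 (p, p)) := by
    have := (hC h).continuous.continuousAt (x := p)
    rw [ContinuousAt, hp h] at this
    exact this.prodMk_nhds tendsto_id
  refine (hs.comp_tendsto ht).congr (fun x => ?_) fun x => rfl
  simp only [Function.comp_apply, mul_smul, ContinuousLinearMap.toSpanSingleton_apply,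
    smul_eq_mul, mul_one]
  ring

/-- **Thurston stability** for `C¹` actions of finitely generated perfect groups on the line. -/
theorem isOpen_fixedPoints_of_contDiff (hfg : Group.FG G)
    (hab : Subsingleton (Abelianization G))
    (hC : ∀ g : G, ContDiff ℝ 1 fun x : ℝ => g • x) :
    IsOpen (MulAction.fixedPoints G ℝ) := by
  obtain ⟨S, hS⟩ := hfg.out
  rw [isOpen_iff_mem_nhds]
  intro p hp
  by_contra hmem
  set u : ℝ → ℝ := fun x => ∑ s ∈ S, |s • x - x|
  have hu_pos : ∀ x, x ∉ MulAction.fixedPoints G ℝ → 0 < u x := by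
    intro x hx
    refine (Finset.sum_nonneg fun s _ => abs_nonneg _).lt_of_ne' fun h0 => hx fun g => ?_
    rw [Finset.sum_eq_zero_iff_of_nonneg fun s _ => abs_nonneg _] at h0
    have : Subgroup.closure (S : Set G) ≤ MulAction.stabilizer G x :=
      (Subgroup.closure_le _).2 fun s hs => by
        simpa [sub_eq_zero] using h0 s hs
    rw [hS] at this
    exact this (Subgroup.mem_top g)
  have hne : (𝓝 p ⊓ 𝓟 (MulAction.fixedPoints G ℝ)ᶜ).NeBot := by
    rw [← frequently_mem_iff_neBot]
    exact fun h => hmem (h.mono fun x hx => not_not.1 hx)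
  let U : Ultrafilter ℝ := Ultrafilter.of (𝓝 p ⊓ 𝓟 (MulAction.fixedPoints G ℝ)ᶜ)
  have hUp : (U : Filter ℝ) ≤ 𝓝 p := (Ultrafilter.of_le _).trans inf_le_left
  have hUu : ∀ᶠ x in (U : Filter ℝ), 0 < u x := by
    filter_upwards [(Ultrafilter.of_le _).trans inf_le_right (mem_principal_self _)] with x hx
    exact hu_pos x hx
  have hadd := fun g h => (isLittleO_displacement_mul hab hC hp g h).mono hUp
  have hO : ∀ g : G, (fun x : ℝ => g • x - x) =O[(U : Filter ℝ)] u := by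
    intro g
    have hg : g ∈ Subgroup.closure (S : Set G) := hS ▸ Subgroup.mem_top g
    induction hg using Subgroup.closure_induction with
    | mem s hs =>
      refine IsBigO.of_bound 1 (Eventually.of_forall fun x => ?_)
      rw [one_mul, Real.norm_eq_abs, Real.norm_eq_abs]
      exact (Finset.single_le_sum (f := fun s : G => |s • x - x|)
        (fun s _ => abs_nonneg _) hs).trans (le_abs_self _)
    | one => simpa using isBigO_zero _ _
    | mul g h _ _ hg hh =>
      exact ((((hadd g h).isBigO.trans hh).add hg).add hh).congr_left fun x => by ring
    | inv g _ hg =>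
      refine ((((hadd g⁻¹ g).isBigO.trans hg).add hg).neg_left).congr_left fun x => ?_
      simp
  have hlim : ∀ g : G, ∃ c : ℝ, Tendsto (fun x : ℝ => (g • x - x) / u x) U (𝓝 c) := by
    intro g
    obtain ⟨C, hC⟩ := (hO g).bound
    have hb : ∀ᶠ x in (U : Filter ℝ), (g • x - x) / u x ∈ Set.Icc (-C) C := by
      filter_upwards [hC, hUu] with x hx hx0
      rw [Set.mem_Icc, ← abs_le, abs_div, div_le_iff₀ (abs_pos.2 hx0.ne')]
      exact hx
    obtain ⟨c, -, hc⟩ := isCompact_Icc.ultrafilter_le_nhds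
      (U.map fun x : ℝ => (g • x - x) / u x) (le_principal_iff.2 hb)
    exact ⟨c, hc⟩
  choose Φ hΦ using hlim
  have hΦ_mul : ∀ g h, Φ (g * h) = Φ g + Φ h := by
    intro g h
    have h0 := ((hadd g h).trans_isBigO (hO h)).tendsto_div_nhds_zero
    have h1 := ((hΦ (g * h)).sub (hΦ g)).sub (hΦ h)
    have := tendsto_nhds_unique h0 (h1.congr fun x => by ring)
    linarith
  have hΦ_zero : ∀ g, Φ g = 0 := fun g =>
    Multiplicative.ofAdd.injective <|
      MonoidHom.apply_eq_one_of_subsingleton_abelianization hab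
        (MonoidHom.mk' (fun g => Multiplicative.ofAdd (Φ g)) fun g h => by
          rw [hΦ_mul, ofAdd_add]) g
  have hsum : Tendsto (fun x => ∑ s ∈ S, |(s • x - x) / u x|) U (𝓝 0) := by
    simpa [hΦ_zero] using tendsto_finsetSum S fun s _ => (hΦ s).abs
  have hone : (fun x => ∑ s ∈ S, |(s • x - x) / u x|) =ᶠ[(U : Filter ℝ)] fun _ => 1 := by
    filter_upwards [hUu] with x hx
    simp_rw [abs_div, abs_of_pos hx, ← Finset.sum_div]
    exact div_self hx.ne'
  exact zero_ne_one (tendsto_nhds_unique (hsum.congr' hone) tendsto_const_nhds)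

/-- A finitely generated perfect group acting on the line by `C¹` maps with a common fixed point
acts trivially. -/
theorem smul_eq_of_contDiff_of_mem_fixedPoints (hfg : Group.FG G)
    (hab : Subsingleton (Abelianization G))
    (hC : ∀ g : G, ContDiff ℝ 1 fun x : ℝ => g • x) {p : ℝ}
    (hp : p ∈ MulAction.fixedPoints G ℝ) (g : G) (x : ℝ) : g • x = x := by
  have hclosed : IsClosed (MulAction.fixedPoints G ℝ) := by
    simp only [MulAction.fixedPoints, Set.ofPred_forall]
    exact isClosed_iInter fun g => isClosed_eq (hC g).continuous continuous_id
  have h := IsClopen.eq_univ ⟨hclosed, isOpen_fixedPoints_of_contDiff hfg hab hC⟩ ⟨p, hp⟩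
  exact (h ▸ Set.mem_univ x : x ∈ MulAction.fixedPoints G ℝ) g

end Thurston

section Lifts

/-- Real numbers with the same reduction modulo one differ by an integer. -/
theorem exists_int_eq_add_of_coe_eq_coe {x y : ℝ} (h : (x : UnitAddCircle) = y) :
    ∃ n : ℤ, y = x + n := by
  obtain ⟨n, hn⟩ := (AddCircle.coe_eq_zero_iff (1 : ℝ) (x := y - x)).1 (by
    rw [AddCircle.coe_sub, h, sub_self])
  rw [zsmul_one] at hn
  exact ⟨n, by linarith⟩

theorem coe_add_intCast_unitAddCircle (x : ℝ) (n : ℤ) :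
    ((x + n : ℝ) : UnitAddCircle) = x := by
  rw [AddCircle.coe_add, (AddCircle.coe_eq_zero_iff (1 : ℝ)).2 ⟨n, zsmul_one n⟩, add_zero]

/-- Two continuous real functions with the same reduction modulo one differ by an integer. -/
theorem exists_int_eq_add_of_coe_eq {F F' : ℝ → ℝ} (hF : Continuous F) (hF' : Continuous F')
    (h : ∀ x, (F x : UnitAddCircle) = F' x) : ∃ n : ℤ, ∀ x, F' x = F x + n := by
  obtain ⟨n, hn⟩ := exists_int_eq_add_of_coe_eq_coe (h 0)
  refine ⟨n, fun x => congrFun ((AddCircle.isCoveringMap_coe (1 : ℝ)).eq_of_comp_eq hF'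
    (hF.add continuous_const) (funext fun x => ?_) 0 hn) x⟩
  simp only [Function.comp_apply, Pi.add_apply]
  rw [coe_add_intCast_unitAddCircle, h]

theorem exists_isOPC1Lift_of_perfect {G : Type*} [Group G]
    (hab : Subsingleton (Abelianization G)) {ρ : G →* (UnitAddCircle ≃ₜ UnitAddCircle)}
    (hρ : IsC1Action ρ) (g : G) : ∃ F : ℝ → ℝ, IsOPC1Lift (ρ g) F := by
  choose F hC hd hdeg hcoe using hρ
  have hdeg' : ∀ g, ∃ d : ℤˣ, ∀ x, F g (x + 1) = F g x + (d : ℤ) := fun g =>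
    (hdeg g).elim (fun h => ⟨1, by simpa using h⟩)
      fun h => ⟨-1, by simpa [sub_eq_add_neg] using h⟩
  choose d hd1 using hdeg'
  have hmul : ∀ g h, d (g * h) = d g * d h := by
    intro g h
    obtain ⟨n, hn⟩ := exists_int_eq_add_of_coe_eq ((hC g).continuous.comp (hC h).continuous)
      (hC (g * h)).continuous fun x => by
        rw [← hcoe, map_mul, Function.comp_apply, ← hcoe, ← hcoe]; rfl
    have hsub : ∀ x, F g (x - 1) = F g x - (d g : ℤ) := fun x => by
      rw [eq_sub_iff_add_eq, ← hd1, sub_add_cancel]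
    have h1 := hd1 (g * h) 0
    rw [hn, hn, Function.comp_apply, Function.comp_apply, hd1] at h1
    have h2 : F g (F h 0 + (d h : ℤ)) = F g (F h 0) + (d g * d h : ℤ) := by
      rcases Int.units_eq_one_or (d h) with e | e
      · simpa [e] using hd1 g (F h 0)
      · simpa [e, sub_eq_add_neg] using hsub (F h 0)
    rw [h2] at h1
    ext
    push_cast
    exact_mod_cast (by linarith : ((d (g * h) : ℤ) : ℝ) = (d g * d h : ℤ))
  have hone : d g = 1 :=
    MonoidHom.apply_eq_one_of_subsingleton_abelianization hab (MonoidHom.mk' d hmul) g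
  have hdeg1 : ∀ x, F g (x + 1) = F g x + 1 := by simpa [hone] using hd1 g
  refine ⟨F g, hC g, ?_, hdeg1, hcoe g⟩
  have hdiff := (hC g).differentiable one_ne_zero
  rcases hasDerivWithinAt_forall_lt_or_forall_gt_of_forall_ne (m := 0) convex_univ
    (fun x _ => (hdiff x).hasDerivAt.hasDerivWithinAt) (fun x _ => hd g x) with h | h
  · have := strictAnti_of_deriv_neg (fun x => h x trivial) (zero_lt_one' ℝ)
    have := hdeg1 0
    rw [zero_add] at this
    linarith
  · exact fun x => h x trivial

theorem IsOPC1Lift.isOPLift {f : UnitAddCircle ≃ₜ UnitAddCircle} {F : ℝ → ℝ}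
    (hF : IsOPC1Lift f F) : IsOPLift f F :=
  ⟨hF.1.continuous, strictMono_of_deriv_pos hF.2.1, hF.2.2⟩

theorem IsOPLift.map_add_int {f : UnitAddCircle ≃ₜ UnitAddCircle} {F : ℝ → ℝ}
    (hF : IsOPLift f F) (x : ℝ) (n : ℤ) : F (x + n) = F x + n :=
  CircleDeg1Lift.map_add_int ⟨⟨F, hF.2.1.monotone⟩, hF.2.2.1⟩ x n

theorem IsOPLift.ceil_map_sub_map {f : UnitAddCircle ≃ₜ UnitAddCircle} {F : ℝ → ℝ}
    (hF : IsOPLift f F) (x y : ℝ) : ⌈F x - F y⌉ = ⌈x - y⌉ :=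
  eq_of_forall_ge_iff fun n => by
    rw [Int.ceil_le, Int.ceil_le, sub_le_iff_le_add', sub_le_iff_le_add', ← hF.map_add_int,
      hF.2.1.le_iff_le]

end Lifts

section CumulativeMass

/-- The signed mass which the `ℤ`-periodic lift to the line of a measure `μ` on the circle gives
to `[0, x)`. -/
noncomputable def cumulativeMass (μ : Measure UnitAddCircle) (x : ℝ) : ℝ :=
  ∫ t, (⌈x - (AddCircle.equivIco 1 0 t : ℝ)⌉ : ℝ) ∂μ

variable (μ : Measure UnitAddCircle) [IsProbabilityMeasure μ]

theorem integrable_ceil_sub_equivIco (x : ℝ) :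
    Integrable (fun t : UnitAddCircle => (⌈x - (AddCircle.equivIco 1 0 t : ℝ)⌉ : ℝ)) μ := by
  have hm : Measurable fun t : UnitAddCircle => (AddCircle.equivIco 1 0 t : ℝ) :=
    measurable_subtype_coe.comp (AddCircle.measurableEquivIco 1 0).measurable
  refine Integrable.of_mem_Icc (x - 1) (x + 1)
    (measurable_from_top.comp (Int.measurable_ceil.comp (hm.const_sub x))).aemeasurable
    (Eventually.of_forall fun t => ?_)
  have ht := (AddCircle.equivIco 1 0 t).2
  have h1 := Int.le_ceil (x - (AddCircle.equivIco 1 0 t : ℝ))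
  have h2 := Int.ceil_lt_add_one (x - (AddCircle.equivIco 1 0 t : ℝ))
  constructor <;> linarith [ht.1, ht.2]

theorem monotone_cumulativeMass : Monotone (cumulativeMass μ) := fun x y hxy =>
  integral_mono (integrable_ceil_sub_equivIco μ x) (integrable_ceil_sub_equivIco μ y) fun _ =>
    Int.cast_le.2 (Int.ceil_mono (sub_le_sub_right hxy _))

theorem cumulativeMass_add_int (x : ℝ) (n : ℤ) :
    cumulativeMass μ (x + n) = cumulativeMass μ x + n := by
  simp only [cumulativeMass, add_sub_right_comm, Int.ceil_add_intCast, Int.cast_add]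
  rw [integral_add (integrable_ceil_sub_equivIco μ x) (integrable_const _)]
  simp

variable {μ} in
theorem IsOPLift.cumulativeMass_sub {f : UnitAddCircle ≃ₜ UnitAddCircle} {F : ℝ → ℝ}
    (hF : IsOPLift f F) (hf : μ.map f = μ) (x y : ℝ) :
    cumulativeMass μ (F x) - cumulativeMass μ (F y) =
      cumulativeMass μ x - cumulativeMass μ y := by
  simp only [cumulativeMass]
  rw [← integral_sub (integrable_ceil_sub_equivIco μ _) (integrable_ceil_sub_equivIco μ _),
    ← integral_sub (integrable_ceil_sub_equivIco μ _) (integrable_ceil_sub_equivIco μ _)]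
  nth_rewrite 1 [← hf]
  rw [f.measurableEmbedding.integral_map]
  congr 1 with t
  obtain ⟨n, hn⟩ : ∃ n : ℤ, (AddCircle.equivIco 1 0 (f t) : ℝ) =
      F (AddCircle.equivIco 1 0 t) + n :=
    exists_int_eq_add_of_coe_eq_coe <| by
      rw [← hF.2.2.2, AddCircle.coe_equivIco, AddCircle.coe_equivIco]
  simp only [hn, ← sub_sub, Int.ceil_sub_intCast, hF.ceil_map_sub_map, Int.cast_sub]
  ring

/-- The periodic lift of `μ` has a point in its support. -/
theorem exists_forall_cumulativeMass_lt :
    ∃ p : ℝ, ∀ a b, a < p → p < b → cumulativeMass μ a < cumulativeMass μ b := by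
  by_contra! h
  have hloc : IsLocallyConstant (cumulativeMass μ) := by
    rw [IsLocallyConstant.iff_eventually_eq]
    intro p
    obtain ⟨a, b, ha, hb, hab⟩ := h p
    have key : ∀ x ∈ Set.Ioo a b, cumulativeMass μ x = cumulativeMass μ a := fun x hx =>
      ((monotone_cumulativeMass μ hx.2.le).trans hab).antisymm
        (monotone_cumulativeMass μ hx.1.le)
    filter_upwards [Ioo_mem_nhds ha hb] with x hx
    rw [key x hx, key p ⟨ha, hb⟩]
  have h1 := cumulativeMass_add_int μ 0 1
  rw [hloc.apply_eq_of_preconnectedSpace (0 + (1 : ℤ)) 0] at h1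
  simp at h1

/-- A perfect group preserving `μ` has lifts preserving the cumulative mass. -/
theorem exists_isOPC1Lift_cumulativeMass_eq {G : Type*} [Group G]
    (hab : Subsingleton (Abelianization G)) {ρ : G →* (UnitAddCircle ≃ₜ UnitAddCircle)}
    (hρ : IsC1Action ρ) (hinv : ∀ g : G, μ.map (ρ g) = μ) (g : G) :
    ∃ F : ℝ → ℝ, IsOPC1Lift (ρ g) F ∧ ∀ x, cumulativeMass μ (F x) = cumulativeMass μ x := by
  choose F hF using exists_isOPC1Lift_of_perfect hab hρ
  have hsub := fun g => (hF g).isOPLift.cumulativeMass_sub (hinv g)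
  have hmul : ∀ g h, ((cumulativeMass μ (F (g * h) 0) - cumulativeMass μ 0 : ℝ) : UnitAddCircle) =
      ((cumulativeMass μ (F g 0) - cumulativeMass μ 0 : ℝ) : UnitAddCircle) +
        ((cumulativeMass μ (F h 0) - cumulativeMass μ 0 : ℝ) : UnitAddCircle) := by
    intro g h
    obtain ⟨n, hn⟩ := exists_int_eq_add_of_coe_eq
      ((hF g).1.continuous.comp (hF h).1.continuous) (hF (g * h)).1.continuous fun x => by
        rw [← (hF (g * h)).2.2.2, map_mul, Function.comp_apply, ← (hF g).2.2.2, ← (hF h).2.2.2]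
        rfl
    rw [← AddCircle.coe_add, ← coe_add_intCast_unitAddCircle (_ + _) n, hn, Function.comp_apply,
      cumulativeMass_add_int]
    congr 1
    linarith [hsub g (F h 0) 0]
  have hzero : ((cumulativeMass μ (F g 0) - cumulativeMass μ 0 : ℝ) : UnitAddCircle) = 0 :=
    Multiplicative.ofAdd.injective <|
      MonoidHom.apply_eq_one_of_subsingleton_abelianization hab
        (MonoidHom.mk' (fun g => Multiplicative.ofAdd
          ((cumulativeMass μ (F g 0) - cumulativeMass μ 0 : ℝ) : UnitAddCircle)) fun g h => by
          rw [hmul, ofAdd_add]) g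
  obtain ⟨n, hn⟩ := (AddCircle.coe_eq_zero_iff 1).1 hzero
  rw [zsmul_one] at hn
  refine ⟨fun x => F g x + (-n : ℤ), ⟨(hF g).1.add contDiff_const, ?_, ?_, ?_⟩, fun x => ?_⟩
  · simpa using (hF g).2.1
  · intro x
    simp only [(hF g).2.2.1]
    ring
  · intro x
    rw [(hF g).2.2.2, coe_add_intCast_unitAddCircle]
  · rw [cumulativeMass_add_int]
    have := hsub g x 0
    push_cast
    linarith

end CumulativeMass

/-- An orientation preserving lift preserving the cumulative mass fixes each point where this mass
increases. -/
theorem apply_eq_of_cumulativeMass_eq {μ : Measure UnitAddCircle} {F : ℝ → ℝ} (hF : Continuous F)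
    (h : ∀ x, cumulativeMass μ (F x) = cumulativeMass μ x) {p : ℝ}
    (hp : ∀ a b, a < p → p < b → cumulativeMass μ a < cumulativeMass μ b) : F p = p := by
  rcases lt_trichotomy (F p) p with hlt | heq | hgt
  · obtain ⟨y, hy, hpy⟩ := (((hF.tendsto p).eventually_lt_const hlt).filter_mono
      nhdsWithin_le_nhds |>.and (self_mem_nhdsWithin (s := Set.Ioi p))).exists
    exact absurd (h y) (hp _ _ hy hpy).ne
  · exact heq
  · obtain ⟨y, hy, hpy⟩ := (((hF.tendsto p).eventually_const_lt hgt).filter_mono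
      nhdsWithin_le_nhds |>.and (self_mem_nhdsWithin (s := Set.Iio p))).exists
    exact absurd (h y) (hp _ _ hpy hy).ne'

/-- **(Case 1 of the main theorem.)** A finitely generated group with trivial
abelianization whose `C¹` action on the circle preserves a Borel probability
measure acts trivially. -/
theorem trivial_action_of_perfect_measure_preserving_C1
    {G : Type*} [Group G] (hfg : Group.FG G)
    (hab : Subsingleton (Abelianization G))
    (ρ : G →* (UnitAddCircle ≃ₜ UnitAddCircle))
    (hρ : IsC1Action ρ)
    (μ : Measure UnitAddCircle) [IsProbabilityMeasure μ]
    (hinv : ∀ g : G, Measure.map (ρ g) μ = μ) :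
    ∀ g : G, ρ g = Homeomorph.refl UnitAddCircle := by
  obtain ⟨p, hp⟩ := exists_forall_cumulativeMass_lt μ
  choose F hF hFμ using exists_isOPC1Lift_cumulativeMass_eq μ hab hρ hinv
  have hFp : ∀ g, F g p = p := fun g =>
    apply_eq_of_cumulativeMass_eq (hF g).1.continuous (hFμ g) hp
  have hone : F 1 = id :=
    (AddCircle.isCoveringMap_coe (1 : ℝ)).eq_of_comp_eq (hF 1).1.continuous continuous_id
      (funext fun x => by
        rw [Function.comp_apply, ← (hF 1).2.2.2, map_one]; rfl) p (hFp 1)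
  have hmul : ∀ g h, F (g * h) = F g ∘ F h := fun g h =>
    (AddCircle.isCoveringMap_coe (1 : ℝ)).eq_of_comp_eq (hF (g * h)).1.continuous
      ((hF g).1.continuous.comp (hF h).1.continuous)
      (funext fun x => by
        simp only [Function.comp_apply]
        rw [← (hF (g * h)).2.2.2, map_mul, ← (hF g).2.2.2, ← (hF h).2.2.2]; rfl) p
      (by simp [hFp])
  let _ : MulAction G ℝ :=
    { smul := fun g x => F g x
      one_smul := fun x => congrFun hone x
      mul_smul := fun g h x => congrFun (hmul g h) x }
  intro g
  ext t
  obtain ⟨x, rfl⟩ := QuotientAddGroup.mk_surjective t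
  have hx : F g x = x :=
    smul_eq_of_contDiff_of_mem_fixedPoints hfg hab (fun g => (hF g).1) (p := p) hFp g x
  exact ((hF g).2.2.2 x).trans (congrArg _ hx)
end
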